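/- For every α with −log(1−q)/log B ≤ α ≤ −log q/log B, the Hausdorff dimension of the level set Ē(μ,α) equals dim_H Ē(μ,α) = min{ log 2/log A, β2^*(α) }, where β2^*(α) = inf_{s∈ℝ}(sα − β2(s)). -/

import Mathlib

open MeasureTheory Filter Set Metric Topology

/-- `moranCyl c w n (x, ℓ)` refines the interval `[x, x + ℓ]` along the binary word `w`,
using the contraction ratio `c k` at step `k` (the first letter of `w` is processed with
index `n`).  The result `(x', ℓ')` describes the interval `[x', x' + ℓ']`. -/
noncomputable def moranCyl (c : ℕ → ℝ) : List Bool → ℕ → ℝ × ℝ → ℝ × ℝ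
  | [], _, st => st
  | bb :: w, n, st =>
      moranCyl c w (n + 1)
        (if bb then (st.1 + st.2 - st.2 / c n, st.2 / c n) else (st.1, st.2 / c n))

/-- The basic interval `I_w` of the Moran construction with ratios `c`. -/
noncomputable def moranI (c : ℕ → ℝ) (w : List Bool) : Set ℝ :=
  Icc (moranCyl c w 1 (0, 1)).1 ((moranCyl c w 1 (0, 1)).1 + (moranCyl c w 1 (0, 1)).2)

/-- The length `|I_w|` of the basic interval `I_w`. -/
noncomputable def moranLen (c : ℕ → ℝ) (w : List Bool) : ℝ :=
  (moranCyl c w 1 (0, 1)).2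

/-- The Moran set `⋂ n ⋃ {I_w : |w| = n}`. -/
noncomputable def moranSet (c : ℕ → ℝ) : Set ℝ :=
  ⋂ n : ℕ, ⋃ w ∈ {w : List Bool | w.length = n}, moranI c w

/-- The mass assigned to the cylinder `I_w` by the Moran measure with weight `r k` for the
letter at step `k`: `cylMass r w 1 1 = μ(I_w)`. -/
noncomputable def cylMass (r : ℕ → ℝ) : List Bool → ℕ → ℝ → ℝ
  | [], _, m => m
  | bb :: w, n, m => cylMass r w (n + 1) (if bb then (1 - r n) * m else r n * m)

/-- Lower local dimension `liminf_{r → 0⁺} log μ(B(x,r)) / log r`. -/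
noncomputable def lowerLocalDim (μ : Measure ℝ) (x : ℝ) : ℝ :=
  liminf (fun rr : ℝ => Real.log (μ (closedBall x rr)).toReal / Real.log rr) (𝓝[>] 0)

/-- Upper local dimension `limsup_{r → 0⁺} log μ(B(x,r)) / log r`. -/
noncomputable def upperLocalDim (μ : Measure ℝ) (x : ℝ) : ℝ :=
  limsup (fun rr : ℝ => Real.log (μ (closedBall x rr)).toReal / Real.log rr) (𝓝[>] 0)

/-- `betaFn ρ C s = -log (ρ^s + (1-ρ)^s) / log C`; so `β₁ = betaFn p A`, `β₂ = betaFn q B`. -/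
noncomputable def betaFn (ρ C : ℝ) (s : ℝ) : ℝ :=
  -Real.log (ρ ^ s + (1 - ρ) ^ s) / Real.log C

/-- The Legendre transform `f^*(α) = inf_s (s α - f(s))`. -/
noncomputable def legendre (f : ℝ → ℝ) (α : ℝ) : ℝ :=
  ⨅ s : ℝ, (s * α - f s)

/-- The modification `β̃₁` of `β₁`, linear on `(0,1)`. -/
noncomputable def betaTilde1 (ρ C : ℝ) (s : ℝ) : ℝ :=
  if s ≤ 0 ∨ 1 ≤ s then betaFn ρ C s
  else (1 - s) * betaFn ρ C 0 + s * betaFn ρ C 1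

/-- `packSup μ X r s` is the supremum of `∑ᵢ μ(B(xᵢ,r))^s` over all finite families of
pairwise disjoint closed balls of radius `r` with centers in `X`. -/
noncomputable def packSup (μ : Measure ℝ) (X : Set ℝ) (rr s : ℝ) : ℝ :=
  sSup {y : ℝ | ∃ t : Finset ℝ, (↑t : Set ℝ) ⊆ X ∧
    (↑t : Set ℝ).Pairwise (fun u v => Disjoint (closedBall u rr) (closedBall v rr)) ∧
    y = ∑ u ∈ t, (μ (closedBall u rr)).toReal ^ s}

namespace Moran

/-- The ratios `c 1, c 2, …` all lie between `B > 2` and `A`. -/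
structure Ratios (A B : ℝ) (c : ℕ → ℝ) : Prop where
  two_lt : 2 < B
  ge : ∀ i, B ≤ c (i + 1)
  le : ∀ i, c (i + 1) ≤ A

/-- The length of the basic intervals of level `n`. -/
noncomputable def len (c : ℕ → ℝ) (n : ℕ) : ℝ := ∏ i ∈ Finset.range n, (c (i + 1))⁻¹

/-- The left end point of the basic interval of level `n` coded by `ω`. -/
noncomputable def leftEnd (c : ℕ → ℝ) (n : ℕ) (ω : ℕ → Bool) : ℝ :=
  ∑ i ∈ Finset.range n, if ω i then len c i - len c (i + 1) else 0

/-- The basic interval of level `n` coded by `ω`. -/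
noncomputable def cyl (c : ℕ → ℝ) (n : ℕ) (ω : ℕ → Bool) : Set ℝ :=
  Icc (leftEnd c n ω) (leftEnd c n ω + len c n)

/-- The mass of the basic interval of level `n` coded by `ω`. -/
noncomputable def mass (r : ℕ → ℝ) (n : ℕ) (ω : ℕ → Bool) : ℝ :=
  ∏ i ∈ Finset.range n, if ω i then 1 - r (i + 1) else r (i + 1)

/-- The point of the Moran set coded by `ω`. -/
noncomputable def coding (c : ℕ → ℝ) (ω : ℕ → Bool) : ℝ := ⨆ n, leftEnd c n ω

/-- The first `n` letters of `ω`. -/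
def word (n : ℕ) (ω : ℕ → Bool) : List Bool := (List.range n).map ω

/-- Extension of a finite word by the letter `false`. -/
def extend {n : ℕ} (v : Fin n → Bool) (i : ℕ) : Bool := if h : i < n then v ⟨i, h⟩ else false

variable {A B : ℝ} {c r : ℕ → ℝ}

lemma len_succ (c : ℕ → ℝ) (n : ℕ) : len c (n + 1) = len c n / c (n + 1) := by
  rw [len, Finset.prod_range_succ, ← len, div_eq_mul_inv]

lemma leftEnd_succ (c : ℕ → ℝ) (n : ℕ) (ω : ℕ → Bool) :
    leftEnd c (n + 1) ω = leftEnd c n ω + if ω n then len c n - len c (n + 1) else 0 := by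
  rw [leftEnd, Finset.sum_range_succ, ← leftEnd]

lemma mass_succ (r : ℕ → ℝ) (n : ℕ) (ω : ℕ → Bool) :
    mass r (n + 1) ω = mass r n ω * if ω n then 1 - r (n + 1) else r (n + 1) := by
  rw [mass, Finset.prod_range_succ, ← mass]

lemma extend_apply {n : ℕ} (v : Fin n → Bool) (i : Fin n) : extend v i = v i := by
  simp [extend]

lemma leftEnd_congr {n : ℕ} {ω ω' : ℕ → Bool} (h : ∀ i < n, ω i = ω' i) :
    leftEnd c n ω = leftEnd c n ω' :=
  Finset.sum_congr rfl fun i hi => by rw [h i (Finset.mem_range.1 hi)]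

lemma cyl_congr {n : ℕ} {ω ω' : ℕ → Bool} (h : ∀ i < n, ω i = ω' i) :
    cyl c n ω = cyl c n ω' := by
  rw [cyl, cyl, leftEnd_congr h]

lemma mass_congr {n : ℕ} {ω ω' : ℕ → Bool} (h : ∀ i < n, ω i = ω' i) :
    mass r n ω = mass r n ω' :=
  Finset.prod_congr rfl fun i hi => by rw [h i (Finset.mem_range.1 hi)]

lemma extend_restrict (n : ℕ) (ω : ℕ → Bool) :
    ∀ i < n, extend (fun j : Fin n => ω j) i = ω i := by
  intro i hi
  simp [extend, hi]

/-! ### The intervals `I_w` in terms of infinite codes -/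

lemma moranCyl_append (c : ℕ → ℝ) (w v : List Bool) (n : ℕ) (st : ℝ × ℝ) :
    moranCyl c (w ++ v) n st = moranCyl c v (n + w.length) (moranCyl c w n st) := by
  induction w generalizing n st with
  | nil => rfl
  | cons b w ih =>
    simp only [List.cons_append, moranCyl, ih, List.length_cons]
    congr 1
    ring

lemma cylMass_append (r : ℕ → ℝ) (w v : List Bool) (n : ℕ) (m : ℝ) :
    cylMass r (w ++ v) n m = cylMass r v (n + w.length) (cylMass r w n m) := by
  induction w generalizing n m with
  | nil => rfl
  | cons b w ih =>
    simp only [List.cons_append, cylMass, ih, List.length_cons]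
    congr 1
    ring

lemma word_succ (n : ℕ) (ω : ℕ → Bool) : word (n + 1) ω = word n ω ++ [ω n] := by
  simp [word, List.range_succ]

lemma length_word (n : ℕ) (ω : ℕ → Bool) : (word n ω).length = n := by simp [word]

lemma moranCyl_word (c : ℕ → ℝ) (n : ℕ) (ω : ℕ → Bool) :
    moranCyl c (word n ω) 1 (0, 1) = (leftEnd c n ω, len c n) := by
  induction n with
  | zero => simp [word, moranCyl, leftEnd, len]
  | succ n ih =>
    rw [word_succ, moranCyl_append, ih, length_word, add_comm 1 n, leftEnd_succ, len_succ]
    cases h : ω n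
    · simp [moranCyl]
    · simp only [moranCyl, if_true, Prod.mk.injEq, and_true]
      ring

lemma moranI_word (c : ℕ → ℝ) (n : ℕ) (ω : ℕ → Bool) : moranI c (word n ω) = cyl c n ω := by
  rw [moranI, moranCyl_word, cyl]

lemma cylMass_word (r : ℕ → ℝ) (n : ℕ) (ω : ℕ → Bool) :
    cylMass r (word n ω) 1 1 = mass r n ω := by
  induction n with
  | zero => simp [word, cylMass, mass]
  | succ n ih =>
    rw [word_succ, cylMass_append, ih, length_word, add_comm 1 n, mass_succ]
    cases h : ω n <;> simp [cylMass, mul_comm]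

lemma exists_word_eq (w : List Bool) : ∃ ω, word w.length ω = w := by
  refine ⟨fun i => w.getD i false, ?_⟩
  apply List.ext_getElem
  · simp [word]
  · intro i h1 h2
    simp [word, h2]

/-! ### Geometry of the basic intervals -/

lemma Ratios.pos (h : Ratios A B c) (i : ℕ) : 0 < c (i + 1) := by
  linarith [h.two_lt, h.ge i]

lemma Ratios.B_pos (h : Ratios A B c) : 0 < B := by linarith [h.two_lt]

lemma Ratios.A_pos (h : Ratios A B c) : 0 < A := lt_of_lt_of_le (h.pos 0) (h.le 0)

lemma Ratios.len_pos (h : Ratios A B c) (n : ℕ) : 0 < len c n :=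
  Finset.prod_pos fun i _ => inv_pos.2 (h.pos i)

lemma Ratios.len_succ_le (h : Ratios A B c) (n : ℕ) : len c (n + 1) ≤ len c n / B := by
  rw [len_succ]
  exact div_le_div_of_nonneg_left (h.len_pos n).le h.B_pos (h.ge n)

lemma Ratios.len_le_succ (h : Ratios A B c) (n : ℕ) : len c n ≤ A * len c (n + 1) := by
  rw [len_succ, mul_div_assoc', le_div_iff₀ (h.pos n), mul_comm]
  exact mul_le_mul_of_nonneg_right (h.le n) (h.len_pos n).le

lemma Ratios.len_succ_lt (h : Ratios A B c) (n : ℕ) : len c (n + 1) < len c n := by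
  refine (h.len_succ_le n).trans_lt (div_lt_self (h.len_pos n) ?_)
  linarith [h.two_lt]

lemma Ratios.len_antitone (h : Ratios A B c) : Antitone (len c) :=
  antitone_nat_of_succ_le fun n => (h.len_succ_lt n).le

lemma Ratios.len_le_pow (h : Ratios A B c) (n : ℕ) : len c n ≤ (1 / B) ^ n := by
  induction n with
  | zero => simp [len]
  | succ n ih =>
    refine (h.len_succ_le n).trans ?_
    rw [pow_succ, div_eq_mul_one_div]
    exact mul_le_mul_of_nonneg_right ih (one_div_pos.2 h.B_pos).le

lemma Ratios.tendsto_len (h : Ratios A B c) : Tendsto (len c) atTop (𝓝 0) := by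
  refine squeeze_zero (fun n => (h.len_pos n).le) h.len_le_pow
    (tendsto_pow_atTop_nhds_zero_of_lt_one (one_div_pos.2 h.B_pos).le ?_)
  rw [div_lt_one h.B_pos]
  linarith [h.two_lt]

lemma Ratios.len_lt_one (h : Ratios A B c) {n : ℕ} (hn : n ≠ 0) : len c n < 1 := by
  obtain ⟨m, rfl⟩ := Nat.exists_eq_succ_of_ne_zero hn
  refine (h.len_succ_lt m).trans_le ((h.len_antitone (Nat.zero_le m)).trans ?_)
  simp [len]

lemma Ratios.leftEnd_mono (h : Ratios A B c) (ω : ℕ → Bool) :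
    Monotone fun n => leftEnd c n ω := by
  refine monotone_nat_of_le_succ fun n => ?_
  rw [leftEnd_succ]
  split_ifs <;> linarith [h.len_succ_lt n]

lemma Ratios.rightEnd_anti (h : Ratios A B c) (ω : ℕ → Bool) :
    Antitone fun n => leftEnd c n ω + len c n := by
  refine antitone_nat_of_succ_le fun n => ?_
  rw [leftEnd_succ]
  split_ifs <;> linarith [h.len_succ_lt n]

lemma Ratios.cyl_anti (h : Ratios A B c) (ω : ℕ → Bool) : Antitone fun n => cyl c n ω :=
  fun _ _ hmn => Icc_subset_Icc (h.leftEnd_mono ω hmn) (h.rightEnd_anti ω hmn)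

lemma Ratios.coding_mem (h : Ratios A B c) (n : ℕ) (ω : ℕ → Bool) :
    coding c ω ∈ cyl c n ω :=
  mem_iInter.1 (Monotone.ciSup_mem_iInter_Icc_of_antitone (h.leftEnd_mono ω)
    (h.rightEnd_anti ω) fun n => by
      show leftEnd c n ω ≤ leftEnd c n ω + len c n
      linarith [h.len_pos n]) n

lemma measurable_coding (c : ℕ → ℝ) : Measurable (coding c) := by
  refine Measurable.iSup fun n => Finset.measurable_sum _ fun i _ => ?_
  exact Measurable.ite (measurableSet_eq_fun (measurable_pi_apply i) measurable_const)
    measurable_const measurable_const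

lemma abs_sub_le_of_mem_cyl {n : ℕ} {ω : ℕ → Bool} {x y : ℝ} (hx : x ∈ cyl c n ω)
    (hy : y ∈ cyl c n ω) : |x - y| ≤ len c n := by
  rw [abs_le]
  constructor <;> linarith [hx.1, hx.2, hy.1, hy.2]

lemma Ratios.gap_pos (h : Ratios A B c) : 0 < 1 - 2 / B := by
  rw [sub_pos, div_lt_one h.B_pos]
  exact h.two_lt

lemma Ratios.gap_le (h : Ratios A B c) {n : ℕ} {ω ω' : ℕ → Bool} {x y : ℝ}
    (hx : x ∈ cyl c (n + 1) ω) (hy : y ∈ cyl c (n + 1) ω') (heq : ∀ i < n, ω i = ω' i)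
    (h0 : ω n = false) (h1 : ω' n = true) : (1 - 2 / B) * len c n ≤ |x - y| := by
  have e := leftEnd_congr (c := c) heq
  have l := h.len_succ_le n
  have hx2 := hx.2
  have hy1 := hy.1
  simp only [leftEnd_succ, h0, h1, if_true] at hx2 hy1
  rw [abs_sub_comm]
  refine le_trans ?_ (le_abs_self _)
  have : (1 - 2 / B) * len c n = len c n - 2 * (len c n / B) := by ring
  rw [this]
  simp at hx2
  linarith

/-- Points of two basic intervals that are close to each other lie in the same interval. -/
lemma Ratios.eq_of_abs_sub_lt (h : Ratios A B c) {n : ℕ} {ω ω' : ℕ → Bool} {x y : ℝ}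
    (hx : x ∈ cyl c n ω) (hy : y ∈ cyl c n ω') (hxy : |x - y| < (1 - 2 / B) * len c n) :
    ∀ i < n, ω i = ω' i := by
  intro i
  induction i using Nat.strong_induction_on with
  | _ i ih =>
    intro hi
    by_contra hne
    have hx' := h.cyl_anti ω (Nat.succ_le_of_lt hi) hx
    have hy' := h.cyl_anti ω' (Nat.succ_le_of_lt hi) hy
    have hlen := mul_le_mul_of_nonneg_left (h.len_antitone hi.le) h.gap_pos.le
    have heq : ∀ j < i, ω j = ω' j := fun j hj => ih j hj (hj.trans hi)
    cases h0 : ω i <;> cases h1 : ω' i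
    · exact hne (h0.trans h1.symm)
    · exact absurd (h.gap_le hx' hy' heq h0 h1) (by linarith)
    · have := h.gap_le hy' hx' (fun j hj => (heq j hj).symm) h1 h0
      rw [abs_sub_comm] at this
      linarith
    · exact hne (h0.trans h1.symm)

lemma Ratios.mem_moranSet_iff (h : Ratios A B c) {x : ℝ} :
    x ∈ moranSet c ↔ ∃ ω, coding c ω = x := by
  constructor
  · intro hx
    have hx' : ∀ n, ∃ ω, x ∈ cyl c n ω := by
      intro n
      obtain ⟨w, hw, hxw⟩ := mem_iUnion₂.1 (mem_iInter.1 hx n)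
      obtain ⟨ω, hω⟩ := exists_word_eq w
      refine ⟨ω, ?_⟩
      rw [mem_ofPred_eq] at hw
      rwa [← moranI_word, ← hw, hω]
    choose f hf using hx'
    have key : ∀ m n, m ≤ n → ∀ i < m, f m i = f n i := fun m n hmn =>
      h.eq_of_abs_sub_lt (hf m) (h.cyl_anti _ hmn (hf n)) (by
        simpa using mul_pos h.gap_pos (h.len_pos m))
    refine ⟨fun i => f (i + 1) i, ?_⟩
    have hmem : ∀ n, x ∈ cyl c n fun i => f (i + 1) i := fun n => by
      rw [cyl_congr fun i hi => key (i + 1) n hi i (Nat.lt_succ_self i)]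
      exact hf n
    have hle : ∀ n, |coding c (fun i => f (i + 1) i) - x| ≤ len c n := fun n =>
      abs_sub_le_of_mem_cyl (h.coding_mem n _) (hmem n)
    have := ge_of_tendsto' h.tendsto_len hle
    exact sub_eq_zero.1 (abs_nonpos_iff.1 this)
  · rintro ⟨ω, rfl⟩
    refine mem_iInter.2 fun n => mem_iUnion₂.2 ⟨word n ω, length_word n ω, ?_⟩
    rw [moranI_word]
    exact h.coding_mem n ω

/-- Summation over words factorizes. -/
lemma sum_extend_prod (n : ℕ) (g : ℕ → Bool → ℝ) :
    ∑ v : Fin n → Bool, ∏ i ∈ Finset.range n, g i (extend v i) =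
      ∏ i ∈ Finset.range n, (g i false + g i true) := by
  have h1 : ∀ v : Fin n → Bool, ∏ i ∈ Finset.range n, g i (extend v i) =
      ∏ i : Fin n, g i (v i) := fun v => by
    rw [Finset.prod_range]
    exact Finset.prod_congr rfl fun i _ => by rw [extend_apply]
  simp_rw [h1]
  rw [Finset.prod_range]
  have := Finset.prod_univ_sum (fun _ : Fin n => (Finset.univ : Finset Bool))
    (fun (i : Fin n) b => g i b)
  rw [Fintype.piFinset_univ] at this
  rw [← this]
  exact Finset.prod_congr rfl fun i _ => by simp [add_comm]

/-! ### The Moran measure and its local dimensions -/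

/-- The weights `r 1, r 2, …` are at most `1 / 2` and bounded from below by `ρ > 0`. -/
structure Weights (ρ : ℝ) (r : ℕ → ℝ) : Prop where
  pos : 0 < ρ
  ge : ∀ i, ρ ≤ r (i + 1)
  le : ∀ i, r (i + 1) ≤ 1 / 2

/-- The quotient `log μ(I_w) / log |I_w|` for the basic interval of level `n` coded by `ω`. -/
noncomputable def ratio (c r : ℕ → ℝ) (ω : ℕ → Bool) (n : ℕ) : ℝ :=
  Real.log (mass r n ω) / Real.log (len c n)

variable {ρ : ℝ} {μ : Measure ℝ}

lemma Weights.factor_mem (hr : Weights ρ r) (i : ℕ) (b : Bool) :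
    ρ ≤ (if b then 1 - r (i + 1) else r (i + 1)) ∧
      (if b then 1 - r (i + 1) else r (i + 1)) ≤ 1 := by
  have := hr.pos
  have := hr.ge i
  have := hr.le i
  split_ifs <;> constructor <;> linarith

lemma Weights.mass_pos (hr : Weights ρ r) (n : ℕ) (ω : ℕ → Bool) : 0 < mass r n ω :=
  Finset.prod_pos fun i _ => hr.pos.trans_le (hr.factor_mem i (ω i)).1

lemma Weights.mass_le_one (hr : Weights ρ r) (n : ℕ) (ω : ℕ → Bool) : mass r n ω ≤ 1 :=
  Finset.prod_le_one (fun i _ => hr.pos.le.trans (hr.factor_mem i (ω i)).1)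
    fun i _ => (hr.factor_mem i (ω i)).2

lemma Weights.pow_le_mass (hr : Weights ρ r) (n : ℕ) (ω : ℕ → Bool) : ρ ^ n ≤ mass r n ω := by
  have := Finset.prod_le_prod (s := Finset.range n) (f := fun _ => ρ)
    (fun _ _ => hr.pos.le) fun i _ => (hr.factor_mem i (ω i)).1
  rwa [Finset.prod_const, Finset.card_range] at this

lemma Ratios.log_len_le (h : Ratios A B c) (n : ℕ) :
    Real.log (len c n) ≤ -(n * Real.log B) := by
  have := Real.log_le_log (h.len_pos n) (h.len_le_pow n)
  rw [Real.log_pow, one_div, Real.log_inv] at this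
  linarith

lemma Ratios.log_B_pos (h : Ratios A B c) : 0 < Real.log B :=
  Real.log_pos (by linarith [h.two_lt])

lemma Ratios.tendsto_log_len (h : Ratios A B c) :
    Tendsto (fun n => Real.log (len c n)) atTop atBot := by
  refine tendsto_atBot_mono h.log_len_le ?_
  exact tendsto_neg_atTop_atBot.comp
    (tendsto_natCast_atTop_atTop.atTop_mul_const h.log_B_pos)

lemma Ratios.log_len_neg (h : Ratios A B c) {n : ℕ} (hn : n ≠ 0) : Real.log (len c n) < 0 :=
  Real.log_neg (h.len_pos n) (h.len_lt_one hn)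

lemma ratio_nonneg (h : Ratios A B c) (hr : Weights ρ r) (ω : ℕ → Bool) (n : ℕ) :
    0 ≤ ratio c r ω n := by
  refine div_nonneg_of_nonpos
    (Real.log_nonpos (hr.mass_pos n ω).le (hr.mass_le_one n ω)) ?_
  refine Real.log_nonpos (h.len_pos n).le ((h.len_antitone (Nat.zero_le n)).trans ?_)
  simp [len]

lemma Weights.log_neg (hr : Weights ρ r) : Real.log ρ < 0 :=
  Real.log_neg hr.pos (by linarith [hr.ge 0, hr.le 0])

lemma ratio_le (h : Ratios A B c) (hr : Weights ρ r) (ω : ℕ → Bool) (n : ℕ) :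
    ratio c r ω n ≤ -Real.log ρ / Real.log B := by
  rcases eq_or_ne n 0 with rfl | hn
  · simpa [ratio, mass] using
      (div_pos (neg_pos.2 hr.log_neg) h.log_B_pos).le
  have h1 := Real.log_le_log (pow_pos hr.pos n) (hr.pow_le_mass n ω)
  rw [Real.log_pow] at h1
  have h2 := h.log_len_le n
  rw [ratio, div_le_iff_of_neg (h.log_len_neg hn)]
  refine le_trans ?_ h1
  have h3 : -Real.log ρ / Real.log B * Real.log (len c n) ≤
      -Real.log ρ / Real.log B * -(n * Real.log B) :=
    mul_le_mul_of_nonneg_left h2 (div_pos (neg_pos.2 hr.log_neg) h.log_B_pos).le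
  refine h3.trans_eq ?_
  have := h.log_B_pos.ne'
  field_simp

lemma Weights.measure_iUnion_cyl [IsProbabilityMeasure μ] (h : Ratios A B c) (hr : Weights ρ r)
    (hμ : ∀ n ω, μ (cyl c n ω) = ENNReal.ofReal (mass r n ω)) (n : ℕ) :
    μ (⋃ v : Fin n → Bool, cyl c n (extend v))ᶜ = 0 := by
  have hmeas : ∀ v : Fin n → Bool, MeasurableSet (cyl c n (extend v)) :=
    fun _ => measurableSet_Icc
  rw [prob_compl_eq_zero_iff (MeasurableSet.iUnion hmeas), measure_iUnion ?_ hmeas]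
  · simp_rw [hμ]
    rw [tsum_fintype, ← ENNReal.ofReal_sum_of_nonneg fun v _ => (hr.mass_pos n _).le]
    have := sum_extend_prod n fun i b => if b then 1 - r (i + 1) else r (i + 1)
    simp only [mass, this]
    simp
  · intro v w hvw
    refine disjoint_left.2 fun x hx hy => hvw ?_
    have := h.eq_of_abs_sub_lt hx hy (by simpa using mul_pos h.gap_pos (h.len_pos n))
    funext i
    rw [← extend_apply v, ← extend_apply w]
    exact this i i.2

lemma measure_closedBall_le [IsProbabilityMeasure μ] (h : Ratios A B c) (hr : Weights ρ r)
    (hμ : ∀ n ω, μ (cyl c n ω) = ENNReal.ofReal (mass r n ω)) {n : ℕ} (ω : ℕ → Bool) {t : ℝ}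
    (ht : t < (1 - 2 / B) * len c n) :
    (μ (closedBall (coding c ω) t)).toReal ≤ mass r n ω := by
  refine ENNReal.toReal_le_of_le_ofReal (hr.mass_pos n ω).le ?_
  rw [← hμ]
  calc μ (closedBall (coding c ω) t)
      ≤ μ (cyl c n ω ∪ (⋃ v : Fin n → Bool, cyl c n (extend v))ᶜ) := by
        refine measure_mono fun y hy => ?_
        by_cases hy' : y ∈ ⋃ v : Fin n → Bool, cyl c n (extend v)
        · obtain ⟨v, hv⟩ := mem_iUnion.1 hy'
          left
          rw [mem_closedBall, Real.dist_eq] at hy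
          rwa [← cyl_congr (h.eq_of_abs_sub_lt hv (h.coding_mem n ω) (hy.trans_lt ht))]
        · exact Or.inr hy'
    _ ≤ μ (cyl c n ω) + μ (⋃ v : Fin n → Bool, cyl c n (extend v))ᶜ := measure_union_le _ _
    _ = μ (cyl c n ω) := by rw [hr.measure_iUnion_cyl h hμ, add_zero]

lemma le_measure_closedBall [IsProbabilityMeasure μ] (h : Ratios A B c)
    (hμ : ∀ n ω, μ (cyl c n ω) = ENNReal.ofReal (mass r n ω)) {n : ℕ} (ω : ℕ → Bool) {t : ℝ}
    (ht : len c n ≤ t) :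
    mass r n ω ≤ (μ (closedBall (coding c ω) t)).toReal := by
  rw [← ENNReal.ofReal_le_iff_le_toReal (measure_ne_top _ _), ← hμ]
  refine measure_mono fun y hy => ?_
  rw [mem_closedBall, Real.dist_eq]
  exact (abs_sub_le_of_mem_cyl hy (h.coding_mem n ω)).trans ht

lemma Ratios.exists_len_le_lt (h : Ratios A B c) {n₀ : ℕ} {t : ℝ} (ht : 0 < t)
    (ht' : t < len c n₀) : ∃ n ≥ n₀, len c (n + 1) ≤ t ∧ t < len c n := by
  classical
  have hex : ∃ n, len c n ≤ t := (h.tendsto_len.eventually_le_const ht).exists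
  have hpos : Nat.find hex ≠ 0 := fun h0 => by
    have := Nat.find_spec hex
    rw [h0] at this
    exact absurd (h.len_antitone (Nat.zero_le n₀)) (by linarith)
  obtain ⟨n, hn⟩ := Nat.exists_eq_succ_of_ne_zero hpos
  have h1 : len c (n + 1) ≤ t := by
    have := Nat.find_spec hex
    rwa [hn] at this
  refine ⟨n, ?_, h1, not_le.1 (Nat.find_min hex (by omega))⟩
  by_contra hlt
  exact absurd (h.len_antitone (show n + 1 ≤ n₀ by omega)) (by linarith)

/-- `log μ(B(x,t)) / log t` is asymptotically at most `γ` iff the same holds for `ratio`. -/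
lemma eventually_localDim_le_iff [IsProbabilityMeasure μ] (h : Ratios A B c) (hr : Weights ρ r)
    (hμ : ∀ n ω, μ (cyl c n ω) = ENNReal.ofReal (mass r n ω)) (ω : ℕ → Bool) (γ : ℝ) :
    (∀ γ' > γ, ∀ᶠ t in 𝓝[>] (0 : ℝ),
      Real.log (μ (closedBall (coding c ω) t)).toReal / Real.log t ≤ γ') ↔
    ∀ γ' > γ, ∀ᶠ n in atTop, ratio c r ω n ≤ γ' := by
  constructor
  · intro H γ' hγ'
    set γ'' := (γ + γ') / 2 with hγ''
    have hlt : γ'' < γ' := by linarith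
    have hgap := h.gap_pos
    have htend : Tendsto (fun n => (1 - 2 / B) / 2 * len c n) atTop (𝓝[>] 0) := by
      refine tendsto_nhdsWithin_iff.2 ⟨?_, Eventually.of_forall fun n => ?_⟩
      · simpa using h.tendsto_len.const_mul ((1 - 2 / B) / 2)
      · exact mul_pos (by linarith) (h.len_pos n)
    have hlog : ∀ᶠ n in atTop, Real.log (len c n) ≤
        γ'' * Real.log ((1 - 2 / B) / 2) / (γ' - γ'') :=
      h.tendsto_log_len.eventually_le_atBot _
    filter_upwards [htend.eventually (H γ'' (by linarith)), hlog,
      eventually_ne_atTop 0] with n hn hl hn0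
    have hg1 : (1 - 2 / B) / 2 < 1 := by
      have : 0 < 2 / B := div_pos two_pos h.B_pos
      linarith
    have hlen := h.len_pos n
    have hlogr : Real.log ((1 - 2 / B) / 2 * len c n) =
        Real.log ((1 - 2 / B) / 2) + Real.log (len c n) :=
      Real.log_mul (by linarith) hlen.ne'
    have hneg : Real.log ((1 - 2 / B) / 2 * len c n) < 0 := by
      rw [hlogr]
      linarith [Real.log_neg (show 0 < (1 - 2 / B) / 2 by linarith) hg1, h.log_len_neg hn0]
    rw [div_le_iff_of_neg hneg, hlogr] at hn
    rw [ratio, div_le_iff_of_neg (h.log_len_neg hn0)]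
    have hball : Real.log (μ (closedBall (coding c ω) ((1 - 2 / B) / 2 * len c n))).toReal ≤
        Real.log (mass r n ω) := by
      refine Real.log_le_log ?_ (measure_closedBall_le h hr hμ ω ?_)
      · obtain ⟨m, hm⟩ := (h.tendsto_len.eventually_le_const
          (show 0 < (1 - 2 / B) / 2 * len c n by positivity)).exists
        exact (hr.mass_pos m ω).trans_le (le_measure_closedBall h hμ ω hm)
      · have : 0 < (1 - 2 / B) * len c n := by positivity
        linarith
    rw [le_div_iff₀ (by linarith)] at hl
    linarith
  · intro H γ' hγ'
    set γ'' := (γ + γ') / 2 with hγ''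
    have hlt : γ'' < γ' := by linarith
    obtain ⟨n₀, hn₀⟩ := eventually_atTop.1 (H γ'' (by linarith))
    have hγ0 : 0 ≤ γ'' := (ratio_nonneg h hr ω n₀).trans (hn₀ n₀ le_rfl)
    have hlog : ∀ᶠ t in 𝓝[>] (0 : ℝ), Real.log t ≤ -(γ'' * Real.log A) / (γ' - γ'') :=
      Real.tendsto_log_nhdsGT_zero.eventually_le_atBot _
    have hsmall : ∀ᶠ t in 𝓝[>] (0 : ℝ), t < len c (n₀ + 1) :=
      (eventually_lt_nhds (h.len_pos _)).filter_mono nhdsWithin_le_nhds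
    filter_upwards [hlog, hsmall, self_mem_nhdsWithin] with t hl hts ht
    have ht : 0 < t := ht
    obtain ⟨n, hn, hle, hlt'⟩ := h.exists_len_le_lt ht hts
    have htneg : Real.log t < 0 :=
      Real.log_neg ht (hts.trans (h.len_lt_one (Nat.succ_ne_zero _)))
    have h1 := hn₀ (n + 1) (by omega)
    rw [ratio, div_le_iff_of_neg (h.log_len_neg n.succ_ne_zero)] at h1
    have h2 := Real.log_le_log (hr.mass_pos (n + 1) ω) (le_measure_closedBall h hμ ω hle)
    have h3 : Real.log t - Real.log A ≤ Real.log (len c (n + 1)) := by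
      rw [← Real.log_div ht.ne' h.A_pos.ne']
      refine Real.log_le_log (div_pos ht h.A_pos) ?_
      rw [div_le_iff₀ h.A_pos, mul_comm]
      exact hlt'.le.trans (h.len_le_succ n)
    have h4 := mul_le_mul_of_nonneg_left h3 hγ0
    rw [div_le_iff_of_neg htneg]
    rw [le_div_iff₀ (by linarith)] at hl
    linarith

lemma limsup_le_iff_forall_gt {ι : Type*} {l : Filter ι} {f : ι → ℝ}
    (h₁ : IsCoboundedUnder (· ≤ ·) l f) (h₂ : IsBoundedUnder (· ≤ ·) l f) {γ : ℝ} :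
    limsup f l ≤ γ ↔ ∀ γ' > γ, ∀ᶠ i in l, f i ≤ γ' := by
  rw [limsup_le_iff h₁ h₂]
  constructor
  · exact fun H γ' hγ' => (H γ' hγ').mono fun i hi => hi.le
  · intro H γ' hγ'
    obtain ⟨δ, hδ, hδ'⟩ := exists_between hγ'
    exact (H δ hδ).mono fun i hi => hi.trans_lt hδ'

lemma isBoundedUnder_ratio (h : Ratios A B c) (hr : Weights ρ r) (ω : ℕ → Bool) :
    IsBoundedUnder (· ≤ ·) atTop (ratio c r ω) :=
  isBoundedUnder_of ⟨_, ratio_le h hr ω⟩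

lemma isCoboundedUnder_ratio (h : Ratios A B c) (hr : Weights ρ r) (ω : ℕ → Bool) :
    IsCoboundedUnder (· ≤ ·) atTop (ratio c r ω) :=
  isCoboundedUnder_le_of_le atTop (ratio_nonneg h hr ω)

/-- The upper local dimension can be computed along the basic intervals. -/
lemma upperLocalDim_coding [IsProbabilityMeasure μ] (h : Ratios A B c) (hr : Weights ρ r)
    (hμ : ∀ n ω, μ (cyl c n ω) = ENNReal.ofReal (mass r n ω)) (ω : ℕ → Bool) :
    upperLocalDim μ (coding c ω) = limsup (ratio c r ω) atTop := by
  refine eq_of_forall_ge_iff fun γ => ?_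
  rw [limsup_le_iff_forall_gt (isCoboundedUnder_ratio h hr ω) (isBoundedUnder_ratio h hr ω),
    ← eventually_localDim_le_iff h hr hμ, upperLocalDim, limsup_le_iff_forall_gt]
  · refine isCoboundedUnder_le_of_eventually_le (x := 0) _ ?_
    have : ∀ᶠ t in 𝓝[>] (0 : ℝ), t < 1 :=
      (eventually_lt_nhds one_pos).filter_mono nhdsWithin_le_nhds
    filter_upwards [this, self_mem_nhdsWithin] with t ht1 ht0
    refine div_nonneg_of_nonpos (Real.log_nonpos ENNReal.toReal_nonneg ?_)
      (Real.log_nonpos (le_of_lt ht0) ht1.le)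
    exact ENNReal.toReal_le_of_le_ofReal zero_le_one (by simpa using prob_le_one)
  · have := (eventually_localDim_le_iff h hr hμ ω (-Real.log ρ / Real.log B)).2
      (fun γ' hγ' => Eventually.of_forall fun n => (ratio_le h hr ω n).trans hγ'.le)
      (-Real.log ρ / Real.log B + 1) (by simp)
    exact ⟨_, this⟩

/-! ### Upper bounds for the Hausdorff dimension -/

lemma ediam_cyl (c : ℕ → ℝ) (n : ℕ) (ω : ℕ → Bool) :
    ediam (cyl c n ω) = ENNReal.ofReal (len c n) := by
  rw [cyl, Real.ediam_Icc, add_sub_cancel_left]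

/-- A set covered infinitely often by families of basic intervals with summable total costs. -/
lemma dimH_le_of_cover (h : Ratios A B c) {E : Set ℝ} {d : ℝ} (hd : 0 ≤ d) (lvl : ℕ → ℕ)
    (hlvl : ∀ j, j ≤ lvl j) (W : ∀ j, Finset (Fin (lvl j) → Bool))
    (hE : ∀ x ∈ E, ∃ᶠ j in atTop, ∃ v ∈ W j, x ∈ cyl c (lvl j) (extend v))
    (hsum : Summable fun j => ((W j).card : ℝ) * len c (lvl j) ^ d) :
    dimH E ≤ ENNReal.ofReal d := by
  have hzero : μH[d] E = 0 := by
    have hr : Tendsto (fun n => ENNReal.ofReal (len c n)) atTop (𝓝 0) := by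
      simpa using ENNReal.tendsto_ofReal h.tendsto_len
    have key := Measure.hausdorffMeasure_le_liminf_tsum d E
      (ι := fun n : ℕ => Σ j : ℕ, W (j + n)) (l := atTop)
      (fun n => ENNReal.ofReal (len c n)) hr
      (fun n jv => cyl c (lvl (jv.1 + n)) (extend jv.2.1))
      (Eventually.of_forall fun n jv => by
        rw [ediam_cyl]
        refine ENNReal.ofReal_le_ofReal (h.len_antitone ?_)
        exact (Nat.le_add_left n jv.1).trans (hlvl _))
      (Eventually.of_forall fun n x hx => by
        obtain ⟨j, hj, v, hv, hxv⟩ := frequently_atTop.1 (hE x hx) n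
        obtain ⟨k, rfl⟩ := Nat.exists_eq_add_of_le' hj
        exact mem_iUnion.2 ⟨⟨k, v, hv⟩, hxv⟩)
    have hcost : ∀ n, (∑' jv : Σ j : ℕ, W (j + n),
        ediam (cyl c (lvl (jv.1 + n)) (extend jv.2.1)) ^ d) =
        ∑' j, ENNReal.ofReal (((W (j + n)).card : ℝ) * len c (lvl (j + n)) ^ d) := by
      intro n
      simp only [ediam_cyl]
      rw [ENNReal.tsum_sigma fun (j : ℕ) (_ : W (j + n)) =>
        ENNReal.ofReal (len c (lvl (j + n))) ^ d]
      refine tsum_congr fun j => ?_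
      rw [tsum_fintype, Finset.sum_const, nsmul_eq_mul, ENNReal.ofReal_mul (Nat.cast_nonneg _),
        ENNReal.ofReal_natCast, ENNReal.ofReal_rpow_of_pos (h.len_pos _)]
      simp
    simp only [hcost] at key
    have htail := ENNReal.tendsto_sum_nat_add
      (fun j => ENNReal.ofReal (((W j).card : ℝ) * len c (lvl j) ^ d)) hsum.tsum_ofReal_ne_top
    rw [htail.liminf_eq] at key
    exact le_antisymm key zero_le
  have := dimH_le_of_hausdorffMeasure_ne_top (s := E) (d := d.toNNReal)
    (by rw [Real.coe_toNNReal d hd, hzero]; exact ENNReal.zero_ne_top)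
  exact this

/-- The contribution of one level to the covering cost. -/
noncomputable def factor (s e ρ C : ℝ) : ℝ := (ρ ^ s + (1 - ρ) ^ s) * C⁻¹ ^ e

lemma card_mul_rpow_le (h : Ratios A B c) {ρ : ℝ} (hr : Weights ρ r) (s γ d : ℝ) (n : ℕ)
    (W : Finset (Fin n → Bool))
    (hW : ∀ v ∈ W, len c n ^ (s * γ) ≤ mass r n (extend v) ^ s) :
    (W.card : ℝ) * len c n ^ d ≤
      ∏ i ∈ Finset.range n, factor s (d - s * γ) (r (i + 1)) (c (i + 1)) := by
  have hlen := h.len_pos n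
  calc (W.card : ℝ) * len c n ^ d
      = ∑ v ∈ W, len c n ^ (s * γ) * len c n ^ (d - s * γ) := by
        rw [Finset.sum_const, nsmul_eq_mul, ← Real.rpow_add hlen]
        congr 2
        ring
    _ ≤ ∑ v ∈ W, mass r n (extend v) ^ s * len c n ^ (d - s * γ) :=
        Finset.sum_le_sum fun v hv => mul_le_mul_of_nonneg_right (hW v hv)
          (Real.rpow_nonneg hlen.le _)
    _ ≤ ∑ v : Fin n → Bool, mass r n (extend v) ^ s * len c n ^ (d - s * γ) :=
        Finset.sum_le_univ_sum_of_nonneg fun v => mul_nonneg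
          (Real.rpow_nonneg (hr.mass_pos n _).le _) (Real.rpow_nonneg hlen.le _)
    _ = (∑ v : Fin n → Bool, ∏ i ∈ Finset.range n,
          (if extend v i then 1 - r (i + 1) else r (i + 1)) ^ s) * len c n ^ (d - s * γ) := by
        rw [Finset.sum_mul]
        refine Finset.sum_congr rfl fun v _ => ?_
        rw [mass, Real.finsetProd_rpow]
        exact fun i _ => hr.pos.le.trans (hr.factor_mem i _).1
    _ = ∏ i ∈ Finset.range n, factor s (d - s * γ) (r (i + 1)) (c (i + 1)) := by
        rw [sum_extend_prod n fun i b => (if b then 1 - r (i + 1) else r (i + 1)) ^ s, len,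
          ← Real.finsetProd_rpow _ _ fun i _ => inv_nonneg.2 (h.pos i).le,
          ← Finset.prod_mul_distrib]
        simp [factor]

lemma dimH_le_of_frequently (h : Ratios A B c) {ρ : ℝ} (hr : Weights ρ r) {E : Set ℝ}
    {d : ℝ} (hd : 0 ≤ d) (s γ : ℝ) (lvl : ℕ → ℕ) (hlvl : ∀ j, j ≤ lvl j)
    (hE : ∀ x ∈ E, ∃ ω, coding c ω = x ∧
      ∃ᶠ j in atTop, len c (lvl j) ^ (s * γ) ≤ mass r (lvl j) ω ^ s)
    (hsum : Summable fun j => ∏ i ∈ Finset.range (lvl j),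
      factor s (d - s * γ) (r (i + 1)) (c (i + 1))) :
    dimH E ≤ ENNReal.ofReal d := by
  classical
  refine dimH_le_of_cover h hd lvl hlvl
    (fun j => Finset.univ.filter fun v =>
      len c (lvl j) ^ (s * γ) ≤ mass r (lvl j) (extend v) ^ s) ?_ ?_
  · intro x hx
    obtain ⟨ω, rfl, hω⟩ := hE x hx
    refine hω.mono fun j hj => ⟨fun i => ω i, ?_, ?_⟩
    · rw [Finset.mem_filter, mass_congr (extend_restrict (lvl j) ω)]
      exact ⟨Finset.mem_univ _, hj⟩
    · rw [cyl_congr (extend_restrict (lvl j) ω)]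
      exact h.coding_mem _ ω
  · refine Summable.of_nonneg_of_le
      (fun j => mul_nonneg (Nat.cast_nonneg _) (Real.rpow_nonneg (h.len_pos _).le _))
      (fun j => card_mul_rpow_le h hr s γ d (lvl j) _ ?_) hsum
    intro v hv
    exact (Finset.mem_filter.1 hv).2

/-! ### The two alternating phases -/

/-- The ratios and weights alternate between the phases `(A, p)` and `(B, q)`, where the phases
change at the rapidly increasing times `N i`. -/
structure Phases (A B p q : ℝ) (N : ℕ → ℕ) (c r : ℕ → ℝ) : Prop where
  B_lt : B < A
  two_lt : 2 < B
  p_pos : 0 < p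
  p_le : p ≤ 1 / 2
  q_pos : 0 < q
  q_le : q ≤ 1 / 2
  N_zero : N 0 = 0
  N_mono : StrictMono N
  N_lim : Tendsto (fun i : ℕ => (N (i + 1) : ℝ) / (N i : ℝ)) atTop atTop
  c_A : ∀ i n : ℕ, N (2 * i) < n → n ≤ N (2 * i + 1) → c n = A
  c_B : ∀ i n : ℕ, N (2 * i + 1) < n → n ≤ N (2 * i + 2) → c n = B
  r_p : ∀ i n : ℕ, N (2 * i) < n → n ≤ N (2 * i + 1) → r n = p
  r_q : ∀ i n : ℕ, N (2 * i + 1) < n → n ≤ N (2 * i + 2) → r n = q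

variable {p q : ℝ} {N : ℕ → ℕ}

lemma Phases.cases (h : Phases A B p q N c r) (i : ℕ) :
    (c (i + 1) = A ∧ r (i + 1) = p) ∨ (c (i + 1) = B ∧ r (i + 1) = q) := by
  classical
  have hex : ∃ k, i + 1 ≤ N k := ⟨i + 1, h.N_mono.id_le (i + 1)⟩
  have hpos : Nat.find hex ≠ 0 := fun h0 => by
    have := Nat.find_spec hex
    rw [h0, h.N_zero] at this
    omega
  obtain ⟨k, hk⟩ := Nat.exists_eq_succ_of_ne_zero hpos
  have h1 : i + 1 ≤ N (k + 1) := by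
    have := Nat.find_spec hex
    rwa [hk] at this
  have h2 : N k < i + 1 := not_le.1 (Nat.find_min hex (by omega))
  obtain ⟨j, hj | hj⟩ := Nat.even_or_odd' k
  · subst hj
    exact Or.inl ⟨h.c_A j _ h2 h1, h.r_p j _ h2 h1⟩
  · subst hj
    exact Or.inr ⟨h.c_B j _ h2 h1, h.r_q j _ h2 h1⟩

lemma Phases.r_eq_p (h : Phases A B p q N c r) {i : ℕ} (hi : c (i + 1) = A) :
    r (i + 1) = p := by
  rcases h.cases i with h1 | h1
  · exact h1.2
  · exact absurd (h1.1.symm.trans hi) h.B_lt.ne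

lemma Phases.eq_of_ne (h : Phases A B p q N c r) {i : ℕ} (hi : c (i + 1) ≠ A) :
    c (i + 1) = B ∧ r (i + 1) = q :=
  (h.cases i).resolve_left fun h1 => hi h1.1

lemma Phases.ratios (h : Phases A B p q N c r) : Ratios A B c where
  two_lt := h.two_lt
  ge i := by rcases h.cases i with h1 | h1 <;> rw [h1.1]; exact h.B_lt.le
  le i := by rcases h.cases i with h1 | h1 <;> rw [h1.1]; exact h.B_lt.le

lemma Phases.weights (h : Phases A B p q N c r) : Weights (min p q) r where
  pos := lt_min h.p_pos h.q_pos
  ge i := by rcases h.cases i with h1 | h1 <;> rw [h1.2] <;> simp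
  le i := by
    rcases h.cases i with h1 | h1 <;> rw [h1.2]
    · exact h.p_le
    · exact h.q_le

open Classical in
/-- The number of levels below `n` in the first phase. -/
noncomputable def numA (A : ℝ) (c : ℕ → ℝ) (n : ℕ) : ℕ :=
  ((Finset.range n).filter fun i => c (i + 1) = A).card

open Classical in
/-- The number of levels below `n` in the second phase. -/
noncomputable def numB (A : ℝ) (c : ℕ → ℝ) (n : ℕ) : ℕ :=
  ((Finset.range n).filter fun i => ¬c (i + 1) = A).card

lemma numA_add_numB (A : ℝ) (c : ℕ → ℝ) (n : ℕ) : numA A c n + numB A c n = n := by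
  rw [numA, numB, Finset.card_filter_add_card_filter_not, Finset.card_range]

lemma Phases.numA_le (h : Phases A B p q N c r) (j : ℕ) :
    numA A c (N (2 * j + 2)) ≤ N (2 * j + 1) := by
  rw [numA, ← Finset.card_range (N (2 * j + 1))]
  refine Finset.card_le_card fun i hi => ?_
  rw [Finset.mem_filter, Finset.mem_range] at hi
  rw [Finset.mem_range]
  by_contra hlt
  have := h.c_B j (i + 1) (by omega) (by omega)
  exact h.B_lt.ne (this.symm.trans hi.2)

lemma Phases.numB_le (h : Phases A B p q N c r) (j : ℕ) :
    numB A c (N (2 * j + 1)) ≤ N (2 * j) := by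
  rw [numB, ← Finset.card_range (N (2 * j))]
  refine Finset.card_le_card fun i hi => ?_
  rw [Finset.mem_filter, Finset.mem_range] at hi
  rw [Finset.mem_range]
  by_contra hlt
  exact hi.2 (h.c_A j (i + 1) (by omega) (by omega))

lemma Phases.eventually_le_mul (h : Phases A B p q N c r) {ε : ℝ} (hε : 0 < ε) :
    ∀ᶠ i in atTop, (N i : ℝ) ≤ ε * N (i + 1) := by
  filter_upwards [h.N_lim.eventually_ge_atTop (1 / ε)] with i hi
  have hpos : (0 : ℝ) < N i := by
    rcases (Nat.cast_nonneg (α := ℝ) (N i)).lt_or_eq with h0 | h0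
    · exact h0
    · rw [← h0, div_zero] at hi
      exact absurd (one_div_pos.2 hε) (not_lt.2 hi)
  rw [div_le_div_iff₀ hε hpos] at hi
  linarith

lemma Phases.eventually_numA_le (h : Phases A B p q N c r) {ε : ℝ} (hε : 0 < ε) :
    ∀ᶠ j in atTop, (numA A c (N (2 * j + 2)) : ℝ) ≤ ε * N (2 * j + 2) := by
  have htend : Tendsto (fun j : ℕ => 2 * j + 1) atTop atTop :=
    tendsto_atTop_mono (fun j => by simp; omega) tendsto_id
  filter_upwards [htend.eventually (h.eventually_le_mul hε)] with j hj
  exact (Nat.cast_le.2 (h.numA_le j)).trans hj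

lemma Phases.eventually_numB_le (h : Phases A B p q N c r) {ε : ℝ} (hε : 0 < ε) :
    ∀ᶠ j in atTop, (numB A c (N (2 * j + 1)) : ℝ) ≤ ε * N (2 * j + 1) := by
  have htend : Tendsto (fun j : ℕ => 2 * j) atTop atTop :=
    tendsto_atTop_mono (fun j => by simp; omega) tendsto_id
  filter_upwards [htend.eventually (h.eventually_le_mul hε)] with j hj
  exact (Nat.cast_le.2 (h.numB_le j)).trans hj

lemma Phases.prod_eq (h : Phases A B p q N c r) (g : ℝ → ℝ → ℝ) (n : ℕ) :
    ∏ i ∈ Finset.range n, g (r (i + 1)) (c (i + 1)) =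
      g p A ^ numA A c n * g q B ^ numB A c n := by
  classical
  have : ∀ i ∈ Finset.range n, g (r (i + 1)) (c (i + 1)) =
      if c (i + 1) = A then g p A else g q B := fun i _ => by
    split_ifs with hi
    · rw [hi, h.r_eq_p hi]
    · rw [(h.eq_of_ne hi).1, (h.eq_of_ne hi).2]
  rw [Finset.prod_congr rfl this, Finset.prod_ite, Finset.prod_const, Finset.prod_const, numA,
    numB]

lemma summable_pow_mul_pow {x y : ℝ} (hx : 0 < x) (hx1 : x < 1) (hy : 0 < y) {a b n : ℕ → ℕ}
    (hab : ∀ j, a j + b j = n j) (hn : ∀ j, j ≤ n j)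
    (hb : ∀ ε > 0, ∀ᶠ j in atTop, (b j : ℝ) ≤ ε * n j) :
    Summable fun j => x ^ a j * y ^ b j := by
  have hlx := Real.log_neg hx hx1
  set D := |Real.log y - Real.log x| + 1 with hD
  have hD0 : 0 < D := by positivity
  refine Summable.of_norm_bounded_eventually_nat (g := fun j => Real.exp (Real.log x / 2) ^ j)
    (summable_geometric_of_lt_one (Real.exp_pos _).le
      (Real.exp_lt_one_iff.2 (by linarith))) ?_
  filter_upwards [hb (-Real.log x / (2 * D)) (div_pos (by linarith) (by linarith))] with j hj
  have hpos : 0 < x ^ a j * y ^ b j := by positivity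
  rw [Real.norm_of_nonneg hpos.le, ← Real.exp_nat_mul, ← Real.log_le_iff_le_exp hpos,
    Real.log_mul (by positivity) (by positivity), Real.log_pow, Real.log_pow]
  have hnj : (a j : ℝ) = n j - b j := by
    rw [← hab j]
    push_cast
    ring
  have hjn : (j : ℝ) ≤ n j := Nat.cast_le.2 (hn j)
  have h1 : (b j : ℝ) * (Real.log y - Real.log x) ≤ b j * D :=
    mul_le_mul_of_nonneg_left (by linarith [le_abs_self (Real.log y - Real.log x)])
      (Nat.cast_nonneg _)
  have h2 : (b j : ℝ) * D ≤ -Real.log x / 2 * n j := by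
    calc (b j : ℝ) * D ≤ -Real.log x / (2 * D) * n j * D :=
          mul_le_mul_of_nonneg_right hj hD0.le
      _ = -Real.log x / 2 * n j := by field_simp
  have h3 : (n j : ℝ) * (Real.log x / 2) ≤ j * (Real.log x / 2) :=
    mul_le_mul_of_nonpos_right hjn (by linarith)
  rw [hnj]
  linarith

lemma Phases.A_gt_one (h : Phases A B p q N c r) : 1 < A := by
  linarith [h.two_lt, h.B_lt]

lemma Phases.log_A_pos (h : Phases A B p q N c r) : 0 < Real.log A := Real.log_pos h.A_gt_one

lemma Phases.log_B_pos (h : Phases A B p q N c r) : 0 < Real.log B := h.ratios.log_B_pos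

lemma Phases.log_B_lt (h : Phases A B p q N c r) : Real.log B < Real.log A :=
  Real.log_lt_log h.ratios.B_pos h.B_lt

lemma rpow_add_rpow_pos {ρ : ℝ} (h0 : 0 < ρ) (h1 : ρ ≤ 1 / 2) (s : ℝ) :
    0 < ρ ^ s + (1 - ρ) ^ s :=
  add_pos (Real.rpow_pos_of_pos h0 s) (Real.rpow_pos_of_pos (by linarith) s)

lemma factor_pos {ρ C : ℝ} (h0 : 0 < ρ) (h1 : ρ ≤ 1 / 2) (hC : 1 < C) (s e : ℝ) :
    0 < factor s e ρ C :=
  mul_pos (rpow_add_rpow_pos h0 h1 s) (Real.rpow_pos_of_pos (inv_pos.2 (by linarith)) e)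

lemma factor_lt_one {ρ C : ℝ} (h0 : 0 < ρ) (h1 : ρ ≤ 1 / 2) (hC : 1 < C) {s e : ℝ}
    (he : -betaFn ρ C s < e) : factor s e ρ C < 1 := by
  have hlog := Real.log_pos hC
  have hCinv : 0 < C⁻¹ := inv_pos.2 (by linarith)
  rw [← Real.log_neg_iff (factor_pos h0 h1 hC s e), factor,
    Real.log_mul (rpow_add_rpow_pos h0 h1 s).ne' (Real.rpow_pos_of_pos hCinv e).ne',
    Real.log_rpow hCinv, Real.log_inv]
  rw [betaFn, neg_div, neg_neg, div_lt_iff₀ hlog] at he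
  linarith

lemma betaFn_zero (ρ C : ℝ) : betaFn ρ C 0 = -(Real.log 2 / Real.log C) := by
  rw [betaFn, Real.rpow_zero, Real.rpow_zero, one_add_one_eq_two, neg_div]

lemma Phases.betaFn_le (h : Phases A B p q N c r)
    (hpq : -Real.log p / Real.log A < -Real.log (1 - q) / Real.log B) {s : ℝ} (hs : s ≤ 0) :
    betaFn q B s ≤ betaFn p A s := by
  have hA := h.log_A_pos
  have hB := h.log_B_pos
  have hp := h.p_pos
  have hq : 0 < 1 - q := by linarith [h.q_le]
  have h1 : Real.log (p ^ s + (1 - p) ^ s) ≤ Real.log 2 + s * Real.log p := by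
    rw [← Real.log_rpow hp, ← Real.log_mul two_ne_zero (Real.rpow_pos_of_pos hp s).ne']
    refine Real.log_le_log (rpow_add_rpow_pos hp h.p_le s) ?_
    have := Real.rpow_le_rpow_of_nonpos hp (show p ≤ 1 - p by linarith [h.p_le]) hs
    linarith
  have h2 : Real.log 2 + s * Real.log (1 - q) ≤ Real.log (q ^ s + (1 - q) ^ s) := by
    rw [← Real.log_rpow hq, ← Real.log_mul two_ne_zero (Real.rpow_pos_of_pos hq s).ne']
    refine Real.log_le_log (mul_pos two_pos (Real.rpow_pos_of_pos hq s)) ?_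
    have := Real.rpow_le_rpow_of_nonpos h.q_pos (show q ≤ 1 - q by linarith [h.q_le]) hs
    linarith
  rw [betaFn, betaFn, neg_div, neg_div, neg_le_neg_iff]
  calc Real.log (p ^ s + (1 - p) ^ s) / Real.log A
      ≤ (Real.log 2 + s * Real.log p) / Real.log A := div_le_div_of_nonneg_right h1 hA.le
    _ = Real.log 2 / Real.log A + -s * (-Real.log p / Real.log A) := by ring
    _ ≤ Real.log 2 / Real.log B + -s * (-Real.log (1 - q) / Real.log B) :=
        add_le_add (div_le_div_of_nonneg_left (Real.log_pos one_lt_two).le hB h.log_B_lt.le)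
          (mul_le_mul_of_nonneg_left hpq.le (neg_nonneg.2 hs))
    _ = (Real.log 2 + s * Real.log (1 - q)) / Real.log B := by ring
    _ ≤ Real.log (q ^ s + (1 - q) ^ s) / Real.log B := div_le_div_of_nonneg_right h2 hB.le

lemma Phases.sub_betaFn_nonneg (h : Phases A B p q N c r) {α : ℝ}
    (hα1 : -Real.log (1 - q) / Real.log B ≤ α) (hα2 : α ≤ -Real.log q / Real.log B) (s : ℝ) :
    0 ≤ s * α - betaFn q B s := by
  have hB := h.log_B_pos
  have hq0 := h.q_pos
  have hq : 0 < 1 - q := by linarith [h.q_le]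
  have key : ∀ t : ℝ, 0 < t → t ^ s ≤ q ^ s + (1 - q) ^ s →
      s * (-Real.log t / Real.log B) ≤ s * α → 0 ≤ s * α - betaFn q B s := by
    intro t ht hts hle
    have h1 := Real.log_le_log (Real.rpow_pos_of_pos ht s) hts
    rw [Real.log_rpow ht] at h1
    have h2 := div_le_div_of_nonneg_right h1 hB.le
    rw [betaFn, neg_div, sub_neg_eq_add]
    have h3 : s * (-Real.log t / Real.log B) = -(s * Real.log t / Real.log B) := by ring
    linarith
  rcases le_total 0 s with hs | hs
  · exact key (1 - q) hq (by linarith [Real.rpow_pos_of_pos hq0 s])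
      (mul_le_mul_of_nonneg_left hα1 hs)
  · exact key q hq0 (by linarith [Real.rpow_pos_of_pos hq s])
      (mul_le_mul_of_nonpos_left hα2 hs)

lemma rpow_le_rpow_mass (h : Ratios A B c) (hr : Weights ρ r) {s γ : ℝ} {n : ℕ}
    {ω : ℕ → Bool} (hle : s * (γ * Real.log (len c n)) ≤ s * Real.log (mass r n ω)) :
    len c n ^ (s * γ) ≤ mass r n ω ^ s := by
  rw [Real.rpow_def_of_pos (h.len_pos n), Real.rpow_def_of_pos (hr.mass_pos n ω), Real.exp_le_exp]
  linarith

lemma Phases.le_N (h : Phases A B p q N c r) (j : ℕ) : j ≤ N j := h.N_mono.id_le j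

lemma Phases.dimH_le_one (h : Phases A B p q N c r) {E : Set ℝ}
    (hE : ∀ x ∈ E, ∃ ω, coding c ω = x) {d : ℝ} (hd : Real.log 2 / Real.log A < d) :
    dimH E ≤ ENNReal.ofReal d := by
  have hd0 : 0 ≤ d := (div_pos (Real.log_pos one_lt_two) h.log_A_pos).le.trans hd.le
  refine dimH_le_of_frequently h.ratios h.weights hd0 0 0 (fun j => N (2 * j + 1))
    (fun j => (by omega : j ≤ 2 * j + 1).trans (h.le_N _)) ?_ ?_
  · intro x hx
    obtain ⟨ω, hω⟩ := hE x hx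
    exact ⟨ω, hω, Frequently.of_forall fun j => by simp⟩
  · simp_rw [h.prod_eq (factor 0 (d - 0 * 0))]
    refine summable_pow_mul_pow (factor_pos h.p_pos h.p_le h.A_gt_one _ _)
      (factor_lt_one h.p_pos h.p_le h.A_gt_one ?_)
      (factor_pos h.q_pos h.q_le (by linarith [h.two_lt]) _ _)
      (fun j => numA_add_numB A c _)
      (fun j => (by omega : j ≤ 2 * j + 1).trans (h.le_N _))
      fun ε hε => h.eventually_numB_le hε
    rw [betaFn_zero]
    linarith

lemma Phases.dimH_le_of_nonneg (h : Phases A B p q N c r) {E : Set ℝ} {α s d : ℝ}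
    (hE : ∀ x ∈ E, ∃ ω, coding c ω = x ∧ limsup (ratio c r ω) atTop = α) (hs : 0 ≤ s)
    (hd0 : 0 ≤ d) (hd : s * α - betaFn q B s < d) :
    dimH E ≤ ENNReal.ofReal d := by
  set γ := α + (d - (s * α - betaFn q B s)) / (s + 1) with hγ
  have hgap : 0 < (d - (s * α - betaFn q B s)) / (s + 1) := div_pos (by linarith) (by linarith)
  have hsγ : s * γ - betaFn q B s < d := by
    have : (d - (s * α - betaFn q B s)) / (s + 1) * (s + 1) = d - (s * α - betaFn q B s) :=
      div_mul_cancel₀ _ (by linarith)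
    rw [hγ]
    linarith
  have hlvl : ∀ j, j ≤ N (2 * j + 2) := fun j =>
    (by omega : j ≤ 2 * j + 2).trans (h.le_N _)
  refine dimH_le_of_frequently h.ratios h.weights hd0 s γ (fun j => N (2 * j + 2)) hlvl ?_ ?_
  · intro x hx
    obtain ⟨ω, hω, hlim⟩ := hE x hx
    refine ⟨ω, hω, Eventually.frequently ?_⟩
    have hev := (limsup_le_iff_forall_gt (isCoboundedUnder_ratio h.ratios h.weights ω)
      (isBoundedUnder_ratio h.ratios h.weights ω)).1 hlim.le γ (by linarith)
    have htend : Tendsto (fun j => N (2 * j + 2)) atTop atTop :=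
      tendsto_atTop_mono hlvl tendsto_id
    filter_upwards [htend.eventually hev, htend.eventually (eventually_ne_atTop 0)] with j hj hj0
    rw [ratio, div_le_iff_of_neg (h.ratios.log_len_neg hj0)] at hj
    exact rpow_le_rpow_mass h.ratios h.weights (mul_le_mul_of_nonneg_left hj hs)
  · simp_rw [h.prod_eq (factor s (d - s * γ)),
      mul_comm (factor s (d - s * γ) p A ^ _)]
    refine summable_pow_mul_pow (factor_pos h.q_pos h.q_le (by linarith [h.two_lt]) _ _)
      (factor_lt_one h.q_pos h.q_le (by linarith [h.two_lt]) (by linarith))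
      (factor_pos h.p_pos h.p_le h.A_gt_one _ _)
      (fun j => (add_comm _ _).trans (numA_add_numB A c _)) hlvl
      fun ε hε => h.eventually_numA_le hε

lemma Phases.dimH_le_of_neg (h : Phases A B p q N c r)
    (hpq : -Real.log p / Real.log A < -Real.log (1 - q) / Real.log B) {E : Set ℝ} {α s d : ℝ}
    (hE : ∀ x ∈ E, ∃ ω, coding c ω = x ∧ limsup (ratio c r ω) atTop = α) (hs : s < 0)
    (hd0 : 0 ≤ d) (hd : s * α - betaFn q B s < d) :
    dimH E ≤ ENNReal.ofReal d := by
  set γ := α + (d - (s * α - betaFn q B s)) / (s - 1) with hγ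
  have hgap : (d - (s * α - betaFn q B s)) / (s - 1) < 0 :=
    div_neg_of_pos_of_neg (by linarith) (by linarith)
  have hsγ : s * γ - betaFn q B s < d := by
    have : (d - (s * α - betaFn q B s)) / (s - 1) * (s - 1) = d - (s * α - betaFn q B s) :=
      div_mul_cancel₀ _ (by linarith)
    rw [hγ]
    linarith
  refine dimH_le_of_frequently h.ratios h.weights hd0 s γ id (fun _ => le_rfl) ?_ ?_
  · intro x hx
    obtain ⟨ω, hω, hlim⟩ := hE x hx
    refine ⟨ω, hω, ?_⟩
    have hfr := frequently_lt_of_lt_limsup (isCoboundedUnder_ratio h.ratios h.weights ω)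
      (show γ < limsup (ratio c r ω) atTop by linarith)
    refine (hfr.and_eventually (eventually_ne_atTop 0)).mono fun n hn => ?_
    have h1 := hn.1
    rw [ratio, lt_div_iff_of_neg (h.ratios.log_len_neg hn.2)] at h1
    exact rpow_le_rpow_mass h.ratios h.weights (mul_le_mul_of_nonpos_left h1.le hs.le)
  · simp_rw [h.prod_eq (factor s (d - s * γ))]
    set x := factor s (d - s * γ) p A
    set y := factor s (d - s * γ) q B
    have hle := h.betaFn_le hpq hs.le
    have hx0 : 0 < x := factor_pos h.p_pos h.p_le h.A_gt_one _ _
    have hy0 : 0 < y := factor_pos h.q_pos h.q_le (by linarith [h.two_lt]) _ _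
    have hx1 : x < 1 := factor_lt_one h.p_pos h.p_le h.A_gt_one (by linarith)
    have hy1 : y < 1 := factor_lt_one h.q_pos h.q_le (by linarith [h.two_lt]) (by linarith)
    refine Summable.of_nonneg_of_le (fun n => by positivity) (fun n => ?_)
      (summable_geometric_of_lt_one (r := max x y) (le_max_of_le_left hx0.le) (max_lt hx1 hy1))
    conv_rhs => rw [← numA_add_numB A c n, pow_add]
    exact mul_le_mul (pow_le_pow_left₀ hx0.le (le_max_left _ _) _)
      (pow_le_pow_left₀ hy0.le (le_max_right _ _) _) (by positivity)
      (pow_nonneg (le_max_of_le_left hx0.le) _)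

lemma le_ofReal_of_forall_gt {a : ENNReal} {x : ℝ} (hx : 0 ≤ x)
    (H : ∀ d, x < d → a ≤ ENNReal.ofReal d) : a ≤ ENNReal.ofReal x := by
  refine ENNReal.le_of_forall_pos_le_add fun ε hε _ => ?_
  rw [← ENNReal.ofReal_coe_nnreal, ← ENNReal.ofReal_add hx ε.coe_nonneg]
  exact H _ (lt_add_of_pos_right x hε)

lemma Phases.dimH_le (h : Phases A B p q N c r)
    (hpq : -Real.log p / Real.log A < -Real.log (1 - q) / Real.log B) {α : ℝ}
    (hα1 : -Real.log (1 - q) / Real.log B ≤ α) (hα2 : α ≤ -Real.log q / Real.log B)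
    {E : Set ℝ} (hE : ∀ x ∈ E, ∃ ω, coding c ω = x ∧ limsup (ratio c r ω) atTop = α) :
    dimH E ≤ ENNReal.ofReal (min (Real.log 2 / Real.log A) (legendre (betaFn q B) α)) := by
  have h1 : dimH E ≤ ENNReal.ofReal (Real.log 2 / Real.log A) :=
    le_ofReal_of_forall_gt (div_pos (Real.log_pos one_lt_two) h.log_A_pos).le fun d hd =>
      h.dimH_le_one (fun x hx => (hE x hx).imp fun _ hω => hω.1) hd
  have h2 : ∀ s, dimH E ≤ ENNReal.ofReal (s * α - betaFn q B s) := fun s => by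
    have hnn := h.sub_betaFn_nonneg hα1 hα2 s
    refine le_ofReal_of_forall_gt hnn fun d hd => ?_
    rcases le_or_gt 0 s with hs | hs
    · exact h.dimH_le_of_nonneg hE hs (hnn.trans hd.le) hd
    · exact h.dimH_le_of_neg hpq hE hs (hnn.trans hd.le) hd
  have hfin : dimH E ≠ ⊤ := ne_top_of_le_ne_top ENNReal.ofReal_ne_top h1
  rw [← ENNReal.ofReal_toReal hfin]
  refine ENNReal.ofReal_le_ofReal (le_min ?_ (le_ciInf fun s => ?_))
  · exact ENNReal.toReal_le_of_le_ofReal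
      (div_pos (Real.log_pos one_lt_two) h.log_A_pos).le h1
  · exact ENNReal.toReal_le_of_le_ofReal (h.sub_betaFn_nonneg hα1 hα2 s) (h2 s)

/-! ### Bernoulli measures on the coding space -/

/-- The measure on `Bool` giving mass `t` to `false` and `1 - t` to `true`. -/
noncomputable def bern (t : ℝ) : Measure Bool :=
  ENNReal.ofReal t • Measure.dirac false + ENNReal.ofReal (1 - t) • Measure.dirac true

lemma isProbabilityMeasure_bern {t : ℝ} (h0 : 0 ≤ t) (h1 : t ≤ 1) :
    IsProbabilityMeasure (bern t) := by
  constructor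
  simp [bern, ← ENNReal.ofReal_add h0 (sub_nonneg.2 h1)]

lemma bern_singleton (t : ℝ) (b : Bool) :
    bern t {b} = ENNReal.ofReal (if b then 1 - t else t) := by
  cases b <;> simp [bern]

lemma integral_bern {t : ℝ} (h0 : 0 ≤ t) (h1 : t ≤ 1) (f : Bool → ℝ) :
    ∫ b, f b ∂(bern t) = t * f false + (1 - t) * f true := by
  rw [bern, integral_add_measure, integral_smul_measure, integral_smul_measure, integral_dirac,
    integral_dirac, ENNReal.toReal_ofReal h0, ENNReal.toReal_ofReal (sub_nonneg.2 h1)]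
  · simp
  · exact (integrable_dirac (by simp)).smul_measure ENNReal.ofReal_ne_top
  · exact (integrable_dirac (by simp)).smul_measure ENNReal.ofReal_ne_top

open ProbabilityTheory in
/-- One half of the strong law of large numbers for centred bounded independent variables. -/
lemma ae_eventually_sum_lt {Ω : Type*} [MeasurableSpace Ω] {P : Measure Ω}
    [IsProbabilityMeasure P] {Y : ℕ → Ω → ℝ} (hY : ∀ i, Measurable (Y i)) (hind : iIndepFun Y P)
    (hb : ∀ i ω, Y i ω ∈ Icc (-1 : ℝ) 1) (h0 : ∀ i, ∫ ω, Y i ω ∂P = 0) {ε : ℝ} (hε : 0 < ε) :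
    ∀ᵐ ω ∂P, ∀ᶠ n : ℕ in atTop, ∑ i ∈ Finset.range n, Y i ω < ε * n := by
  have hbound : ∀ n : ℕ, P {ω | ε * n ≤ ∑ i ∈ Finset.range n, Y i ω} ≤
      ENNReal.ofReal (Real.exp (-(ε ^ 2 / 2)) ^ n) := by
    intro n
    have := HasSubgaussianMGF.measure_sum_range_ge_le_of_iIndepFun hind (n := n)
      (fun i _ => hasSubgaussianMGF_of_mem_Icc_of_integral_eq_zero (hY i).aemeasurable
        (Eventually.of_forall (hb i)) (h0 i)) (mul_nonneg hε.le n.cast_nonneg)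
    rw [← ENNReal.ofReal_toReal (measure_ne_top P _)]
    refine ENNReal.ofReal_le_ofReal (this.trans_eq ?_)
    rw [← Real.exp_nat_mul]
    congr 1
    rcases eq_or_ne n 0 with rfl | hn
    · simp
    · have : (n : ℝ) ≠ 0 := Nat.cast_ne_zero.2 hn
      norm_num
      field_simp
  have hsum : ∑' n : ℕ, P {ω | ε * n ≤ ∑ i ∈ Finset.range n, Y i ω} ≠ ⊤ := by
    refine ne_top_of_le_ne_top ?_ (ENNReal.tsum_le_tsum hbound)
    refine Summable.tsum_ofReal_ne_top (summable_geometric_of_lt_one (Real.exp_pos _).le ?_)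
    rw [Real.exp_lt_one_iff]
    linarith [pow_pos hε 2]
  filter_upwards [ae_eventually_notMem hsum] with ω hω
  filter_upwards [hω] with n hn
  exact not_le.1 hn

open ProbabilityTheory in
/-- The product of Bernoulli measures, with its law of large numbers. -/
lemma exists_bernoulli {ϑ w : ℕ → ℝ} (h0 : ∀ i, 0 ≤ ϑ i) (h1 : ∀ i, ϑ i ≤ 1)
    (hw : ∀ i, |w i| ≤ 1) :
    ∃ P : Measure (ℕ → Bool), IsProbabilityMeasure P ∧
      (∀ n ω, P {ω' | ∀ i < n, ω' i = ω i} = ENNReal.ofReal (mass ϑ n ω)) ∧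
      ∀ᵐ ω ∂P, ∀ ε > 0, ∀ᶠ n : ℕ in atTop,
        |∑ i ∈ Finset.range n, w i * ((if ω i then 0 else 1) - ϑ (i + 1))| ≤ ε * n := by
  have : ∀ i, IsProbabilityMeasure (bern (ϑ (i + 1))) := fun i =>
    isProbabilityMeasure_bern (h0 _) (h1 _)
  refine ⟨Measure.infinitePi fun i => bern (ϑ (i + 1)), inferInstance, fun n ω => ?_, ?_⟩
  · have := Measure.infinitePi_pi (fun i => bern (ϑ (i + 1))) (s := Finset.range n)
      (t := fun i => {ω i}) fun i _ => measurableSet_singleton _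
    have hset : {ω' : ℕ → Bool | ∀ i < n, ω' i = ω i} =
        Set.pi (Finset.range n : Set ℕ) fun i => {ω i} := by
      ext ω'
      simp [Set.mem_pi]
    rw [hset, this, mass, ENNReal.ofReal_prod_of_nonneg]
    · exact Finset.prod_congr rfl fun i _ => bern_singleton _ _
    · intro i _
      split_ifs
      · exact sub_nonneg.2 (h1 _)
      · exact h0 _
  · set P := Measure.infinitePi fun i => bern (ϑ (i + 1))
    have key : ∀ v : ℕ → ℝ, (∀ i, |v i| ≤ 1) → ∀ ε : ℝ, 0 < ε → ∀ᵐ ω ∂P,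
        ∀ᶠ n : ℕ in atTop,
          ∑ i ∈ Finset.range n, v i * ((if ω i then 0 else 1) - ϑ (i + 1)) < ε * n := by
      intro v hv ε hε
      have hind := iIndepFun_infinitePi (P := fun i => bern (ϑ (i + 1)))
        (X := fun i (b : Bool) => v i * ((if b then 0 else 1) - ϑ (i + 1)))
        fun i => measurable_from_top
      refine ae_eventually_sum_lt (fun i => (measurable_from_top
        (f := fun b : Bool => v i * ((if b then 0 else 1) - ϑ (i + 1)))).comp
        (measurable_pi_apply i)) hind (fun i ω => ?_) (fun i => ?_) hε
      · refine abs_le.1 ?_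
        rw [Function.comp_apply, abs_mul]
        refine mul_le_one₀ (hv i) (abs_nonneg _) (abs_le.2 ?_)
        have := h0 (i + 1)
        have := h1 (i + 1)
        split_ifs <;> constructor <;> linarith
      · have hmp := measurePreserving_eval_infinitePi (fun i => bern (ϑ (i + 1))) i
        have := integral_bern (h0 (i + 1)) (h1 (i + 1))
          fun b => v i * ((if b then 0 else 1) - ϑ (i + 1))
        rw [← hmp.map_eq, integral_map hmp.measurable.aemeasurable
          (measurable_from_top).aestronglyMeasurable] at this
        refine this.trans ?_
        simp
        ring
    have hall : ∀ᵐ ω ∂P, ∀ k : ℕ, ∀ᶠ n : ℕ in atTop,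
        |∑ i ∈ Finset.range n, w i * ((if ω i then 0 else 1) - ϑ (i + 1))| ≤
          1 / ((k : ℝ) + 1) * n := by
      refine ae_all_iff.2 fun k => ?_
      filter_upwards [key w hw _ (Nat.one_div_pos_of_nat (n := k)),
        key (fun i => -w i) (fun i => by simpa using hw i) _ (Nat.one_div_pos_of_nat (n := k))]
        with ω hω₁ hω₂
      filter_upwards [hω₁, hω₂] with n hn₁ hn₂
      simp only [neg_mul, Finset.sum_neg_distrib] at hn₂
      exact abs_le.2 ⟨by linarith, hn₁.le⟩
    filter_upwards [hall] with ω hω ε hε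
    obtain ⟨k, hk⟩ := exists_nat_one_div_lt hε
    filter_upwards [hω k] with n hn
    exact hn.trans (mul_le_mul_of_nonneg_right hk.le n.cast_nonneg)

/-! ### Lower bounds for the Hausdorff dimension -/

/-- The mass distribution principle on the coding space. -/
lemma ofReal_le_dimH (h : Ratios A B c) {P : Measure (ℕ → Bool)} [IsProbabilityMeasure P]
    {E : Set ℝ} {d : ℝ} (hd : 0 < d) (hE : ∀ᵐ ω ∂P, coding c ω ∈ E)
    (hP : ∀ᵐ ω ∂P, ∀ᶠ n in atTop, P {ω' | ∀ i < n, ω' i = ω i} ≤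
      ENNReal.ofReal (((1 - 2 / B) / A * len c n) ^ d)) :
    ENNReal.ofReal d ≤ dimH E := by
  set F : ℕ → Set (ℕ → Bool) := fun m => {ω | ∀ n ≥ m, P {ω' | ∀ i < n, ω' i = ω i} ≤
      ENNReal.ofReal (((1 - 2 / B) / A * len c n) ^ d)} with hF
  have hgap := h.gap_pos
  have hA := h.A_pos
  obtain ⟨m, hm⟩ : ∃ m, P (F m) ≠ 0 := by
    by_contra! hcon
    have hU : P (⋃ m, F m) = 0 := measure_iUnion_null hcon
    have hU' : ∀ᵐ ω ∂P, ω ∈ ⋃ m, F m := by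
      filter_upwards [hP] with ω hω
      obtain ⟨m, hm⟩ := eventually_atTop.1 hω
      exact mem_iUnion.2 ⟨m, hm⟩
    have := prob_compl_eq_zero_iff₀ (μ := P) (s := ⋃ m, F m)
      (NullMeasurableSet.of_null hU) |>.1 hU'
    rw [hU] at this
    exact zero_ne_one this
  set ν : Measure ℝ := (P.restrict (F m)).map (coding c) with hν
  have hle : ν ≤ μH[d] := by
    refine Measure.le_hausdorffMeasure d ν (ENNReal.ofReal ((1 - 2 / B) * len c m / 2))
      (ENNReal.ofReal_pos.2 (half_pos (mul_pos hgap (h.len_pos m)))) fun s hs => ?_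
    refine (measure_mono subset_closure).trans ?_
    rw [hν, Measure.map_apply (measurable_coding c) isClosed_closure.measurableSet,
      Measure.restrict_apply (measurable_coding c isClosed_closure.measurableSet),
      ← ediam_closure s]
    rw [← ediam_closure s] at hs
    set K := closure s
    rcases (coding c ⁻¹' K ∩ F m).eq_empty_or_nonempty with hemp | ⟨ω, hωK, hωF⟩
    · simp [hemp]
    have hfin : ediam K ≠ ⊤ := ne_top_of_le_ne_top ENNReal.ofReal_ne_top hs
    have hδ : ediam K = ENNReal.ofReal (diam K) := (ENNReal.ofReal_toReal hfin).symm
    have hδm : diam K < (1 - 2 / B) * len c m := by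
      have h1 := mul_pos hgap (h.len_pos m)
      rw [hδ, ENNReal.ofReal_le_ofReal_iff (half_pos h1).le] at hs
      linarith
    have hmain : ∀ n ≥ m, diam K < (1 - 2 / B) * len c n →
        P (coding c ⁻¹' K ∩ F m) ≤ ENNReal.ofReal (((1 - 2 / B) / A * len c n) ^ d) := by
      intro n hn hlt
      refine (measure_mono ?_).trans (hωF n hn)
      rintro ω' ⟨hω', -⟩
      refine h.eq_of_abs_sub_lt (h.coding_mem n ω') (h.coding_mem n ω) (lt_of_le_of_lt ?_ hlt)
      have := dist_le_diam_of_mem (isBounded_iff_ediam_ne_top.2 hfin) hω' hωK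
      rwa [Real.dist_eq] at this
    rcases (diam_nonneg (s := K)).eq_or_lt with h0 | hpos
    · have hlim : Tendsto (fun n => ENNReal.ofReal (((1 - 2 / B) / A * len c n) ^ d)) atTop
          (𝓝 0) := by
        have := ((h.tendsto_len.const_mul ((1 - 2 / B) / A)).rpow_const
          (p := d) (Or.inr hd.le))
        simpa [Real.zero_rpow hd.ne'] using ENNReal.tendsto_ofReal this
      refine (ge_of_tendsto hlim ?_).trans zero_le
      filter_upwards [eventually_ge_atTop m] with n hn
      exact hmain n hn (by rw [← h0]; exact mul_pos hgap (h.len_pos n))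
    · obtain ⟨n, hn, hn₁, hn₂⟩ := h.exists_len_le_lt (t := diam K / (1 - 2 / B)) (n₀ := m)
        (div_pos hpos hgap) (by rw [div_lt_iff₀ hgap]; linarith)
      refine (hmain n hn ?_).trans ?_
      · rw [div_lt_iff₀ hgap] at hn₂
        linarith
      · rw [hδ, ENNReal.ofReal_rpow_of_pos hpos]
        refine ENNReal.ofReal_le_ofReal (Real.rpow_le_rpow
          (mul_pos (div_pos hgap hA) (h.len_pos n)).le ?_ hd.le)
        have h2 := h.len_le_succ n
        rw [le_div_iff₀ hgap] at hn₁
        calc (1 - 2 / B) / A * len c n ≤ (1 - 2 / B) / A * (A * len c (n + 1)) :=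
              mul_le_mul_of_nonneg_left h2 (div_pos hgap hA).le
          _ = len c (n + 1) * (1 - 2 / B) := by
              field_simp
          _ ≤ diam K := hn₁
  have hνE : ν E ≠ 0 := by
    refine ne_of_gt (lt_of_lt_of_le ?_
      (Measure.le_map_apply (measurable_coding c).aemeasurable E))
    have hae : coding c ⁻¹' E =ᵐ[P.restrict (F m)] univ :=
      eventuallyEq_univ.2 (ae_restrict_of_ae hE)
    rw [measure_congr hae, Measure.restrict_apply_univ]
    exact pos_iff_ne_zero.2 hm
  have := le_dimH_of_hausdorffMeasure_ne_zero (s := E) (d := d.toNNReal) (by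
    rw [Real.coe_toNNReal d hd.le]
    exact ne_of_gt (lt_of_lt_of_le (pos_iff_ne_zero.2 hνE) (hle E)))
  exact this

open Classical in
/-- The weights of the auxiliary Bernoulli measure: `1 / 2` in the first phase and `t` in the
second phase. -/
noncomputable def tilt (A t : ℝ) (c : ℕ → ℝ) (n : ℕ) : ℝ := if c n = A then 1 / 2 else t

open Classical in
/-- The indicator of the levels of the second phase. -/
noncomputable def indB (A : ℝ) (c : ℕ → ℝ) (i : ℕ) : ℝ := if c (i + 1) = A then 0 else 1

/-- The deviation of the number of zeros in the second phase from its mean. -/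
noncomputable def deviation (A t : ℝ) (c : ℕ → ℝ) (ω : ℕ → Bool) (n : ℕ) : ℝ :=
  ∑ i ∈ Finset.range n, indB A c i * ((if ω i then 0 else 1) - tilt A t c (i + 1))

open Classical in
lemma sum_phase (A : ℝ) (c : ℕ → ℝ) (x y : ℝ) (n : ℕ) :
    ∑ i ∈ Finset.range n, (if c (i + 1) = A then x else y) =
      numA A c n * x + numB A c n * y := by
  rw [Finset.sum_ite, Finset.sum_const, Finset.sum_const, numA, numB, nsmul_eq_mul, nsmul_eq_mul]

lemma log_mass_tilt {t : ℝ} (h0 : 0 < t) (h1 : t < 1) (A : ℝ) (c : ℕ → ℝ) (ω : ℕ → Bool) (n : ℕ) :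
    Real.log (mass (tilt A t c) n ω) = -(numA A c n * Real.log 2) +
      numB A c n * (t * Real.log t + (1 - t) * Real.log (1 - t)) +
        deviation A t c ω n * (Real.log t - Real.log (1 - t)) := by
  classical
  have hh : Real.log (1 / 2) = -Real.log 2 := by rw [one_div, Real.log_inv]
  have hhalf : (1 : ℝ) - 1 / 2 = 1 / 2 := by norm_num
  have h2 := sum_phase A c (-Real.log 2) (t * Real.log t + (1 - t) * Real.log (1 - t)) n
  rw [← mul_neg, ← h2, deviation, Finset.sum_mul, ← Finset.sum_add_distrib, mass, Real.log_prod]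
  · refine Finset.sum_congr rfl fun i _ => ?_
    by_cases hc : c (i + 1) = A <;> cases ω i <;> simp only [tilt, indB, hc, if_true, if_false,
      Bool.false_eq_true, hhalf, hh] <;> ring
  · intro i _
    have := sub_pos.2 h1
    by_cases hc : c (i + 1) = A <;> cases ω i <;> simp [tilt, hc] <;> linarith

lemma Phases.log_mass_mem (h : Phases A B p q N c r) (t : ℝ) (ω : ℕ → Bool) (n : ℕ) :
    Real.log (mass r n ω) ∈ Icc (numA A c n * Real.log p +
      numB A c n * (t * Real.log q + (1 - t) * Real.log (1 - q)) +
        deviation A t c ω n * (Real.log q - Real.log (1 - q)))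
      (numB A c n * (t * Real.log q + (1 - t) * Real.log (1 - q)) +
        deviation A t c ω n * (Real.log q - Real.log (1 - q))) := by
  classical
  have hp1 : 0 < 1 - p := by linarith [h.p_le]
  have hq1 : 0 < 1 - q := by linarith [h.q_le]
  have hlp : Real.log p ≤ Real.log (1 - p) := Real.log_le_log h.p_pos (by linarith [h.p_le])
  have hlp0 : Real.log (1 - p) ≤ 0 := Real.log_nonpos hp1.le (by linarith [h.p_pos])
  have hlog : Real.log (mass r n ω) = ∑ i ∈ Finset.range n,
      Real.log (if ω i then 1 - r (i + 1) else r (i + 1)) := by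
    rw [mass, Real.log_prod]
    intro i _
    have := h.weights.factor_mem i (ω i)
    exact (h.weights.pos.trans_le this.1).ne'
  have h2 := sum_phase A c (Real.log p) (t * Real.log q + (1 - t) * Real.log (1 - q)) n
  have h3 := sum_phase A c 0 (t * Real.log q + (1 - t) * Real.log (1 - q)) n
  rw [mul_zero, zero_add] at h3
  rw [hlog, ← h2, ← h3, deviation, Finset.sum_mul, ← Finset.sum_add_distrib,
    ← Finset.sum_add_distrib]
  constructor <;>
  · refine Finset.sum_le_sum fun i _ => ?_
    by_cases hc : c (i + 1) = A
    · rw [h.r_eq_p hc]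
      cases ω i <;> simp only [tilt, indB, hc, if_true, if_false, Bool.false_eq_true] <;> linarith
    · rw [(h.eq_of_ne hc).2]
      cases ω i <;> simp only [tilt, indB, hc, if_true, if_false, Bool.false_eq_true] <;> linarith

lemma Phases.log_len (h : Phases A B p q N c r) (n : ℕ) :
    Real.log (len c n) = -(numA A c n * Real.log A + numB A c n * Real.log B) := by
  rw [len, h.prod_eq (fun _ C => C⁻¹), Real.log_mul (pow_pos (inv_pos.2 h.ratios.A_pos) _).ne'
    (pow_pos (inv_pos.2 h.ratios.B_pos) _).ne', Real.log_pow, Real.log_pow, Real.log_inv,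
    Real.log_inv]
  ring

lemma Phases.limsup_ratio (h : Phases A B p q N c r) {α t : ℝ} (hα0 : 0 ≤ α)
    (hα : -Real.log p ≤ α * Real.log A)
    (ht : α * Real.log B = -(t * Real.log q + (1 - t) * Real.log (1 - q))) {ω : ℕ → Bool}
    (hω : ∀ ε > 0, ∀ᶠ n : ℕ in atTop, |deviation A t c ω n| ≤ ε * n) :
    limsup (ratio c r ω) atTop = α := by
  have hlA := h.log_A_pos
  have hlB := h.log_B_pos
  set K := |Real.log q - Real.log (1 - q)| with hK
  have hK0 : 0 ≤ K := abs_nonneg _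
  set D := α * Real.log A + K + 1 with hD
  have hD0 : 0 < D := by positivity
  have hdev : ∀ ε, 0 < ε → ∀ᶠ n : ℕ in atTop,
      |deviation A t c ω n * (Real.log q - Real.log (1 - q))| ≤ ε * K * n := by
    intro ε hε
    filter_upwards [hω ε hε] with n hn
    rw [abs_mul]
    calc _ ≤ ε * n * K := mul_le_mul_of_nonneg_right hn hK0
      _ = ε * K * n := by ring
  have hAB : ∀ n : ℕ, (numA A c n : ℝ) + numB A c n = n := fun n => by
    exact_mod_cast numA_add_numB A c n
  have hsmall : ∀ η, 0 < η → 0 < η * Real.log B / D := fun η hη => by positivity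
  have hlen : ∀ n : ℕ, 0 < n → Real.log (len c n) < 0 ∧
      Real.log (len c n) ≤ -(n * Real.log B) := fun n hn =>
    ⟨h.ratios.log_len_neg hn.ne', h.ratios.log_len_le n⟩
  refine le_antisymm ?_ ?_
  · rw [limsup_le_iff_forall_gt (isCoboundedUnder_ratio h.ratios h.weights ω)
      (isBoundedUnder_ratio h.ratios h.weights ω)]
    intro α' hα'
    have hη := sub_pos.2 hα'
    filter_upwards [hdev _ (hsmall _ hη), eventually_gt_atTop 0] with n hn hn0
    obtain ⟨hneg, hle⟩ := hlen n hn0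
    rw [ratio, div_le_iff_of_neg hneg]
    have h1 := (h.log_mass_mem t ω n).1
    have h2 := (abs_le.1 hn).1
    have h3 : (α' - α) * Real.log B / D * K * n ≤ (α' - α) * Real.log B * n := by
      refine mul_le_mul_of_nonneg_right ?_ n.cast_nonneg
      rw [div_mul_eq_mul_div, div_le_iff₀ hD0]
      refine mul_le_mul_of_nonneg_left ?_ (by positivity)
      have : 0 ≤ α * Real.log A := by positivity
      linarith
    have h4 : (α' - α) * Real.log (len c n) ≤ (α' - α) * -(n * Real.log B) :=
      mul_le_mul_of_nonneg_left hle hη.le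
    have h5 : (numA A c n : ℝ) * -Real.log p ≤ numA A c n * (α * Real.log A) :=
      mul_le_mul_of_nonneg_left hα (Nat.cast_nonneg _)
    have h6 : α * Real.log (len c n) =
        -(numA A c n * (α * Real.log A) + numB A c n * (α * Real.log B)) := by
      rw [h.log_len]
      ring
    rw [ht] at h6
    linarith
  · refine le_of_forall_lt_imp_le_of_dense fun α' hα' => ?_
    have hη := sub_pos.2 hα'
    refine le_limsup_of_frequently_le ?_ (isBoundedUnder_ratio h.ratios h.weights ω)
    have htend : Tendsto (fun j => N (2 * j + 2)) atTop atTop :=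
      tendsto_atTop_mono (fun j => by have := h.le_N (2 * j + 2); simp only [id]; omega) tendsto_id
    refine htend.frequently (Eventually.frequently ?_)
    filter_upwards [h.eventually_numA_le (hsmall _ hη),
      htend.eventually (hdev _ (hsmall _ hη)), htend.eventually (eventually_gt_atTop 0)]
      with j hj hn hn0
    set n := N (2 * j + 2)
    obtain ⟨hneg, hle⟩ := hlen n hn0
    rw [ratio, le_div_iff_of_neg hneg]
    have h1 := (h.log_mass_mem t ω n).2
    have h2 := (abs_le.1 hn).2
    have h3 : (α - α') * Real.log B / D * (α * Real.log A + K) * n ≤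
        (α - α') * Real.log B * n := by
      refine mul_le_mul_of_nonneg_right ?_ n.cast_nonneg
      rw [div_mul_eq_mul_div, div_le_iff₀ hD0]
      refine mul_le_mul_of_nonneg_left ?_ (by positivity)
      linarith
    have h4 : (α - α') * Real.log (len c n) ≤ (α - α') * -(n * Real.log B) :=
      mul_le_mul_of_nonneg_left hle hη.le
    have h5 : (numA A c n : ℝ) * (α * Real.log A) ≤
        (α - α') * Real.log B / D * n * (α * Real.log A) :=
      mul_le_mul_of_nonneg_right hj (by positivity)
    have h6 : α * Real.log (len c n) =
        -(numA A c n * (α * Real.log A) + numB A c n * (α * Real.log B)) := by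
      rw [h.log_len]
      ring
    rw [ht] at h6
    linarith

lemma Phases.eventually_mass_tilt_le (h : Phases A B p q N c r) {d t : ℝ} (h0 : 0 < t) (h1 : t < 1)
    (hdA : d * Real.log A < Real.log 2)
    (hdB : d * Real.log B < -(t * Real.log t + (1 - t) * Real.log (1 - t)))
    {κ : ℝ} (hκ : 0 < κ) {ω : ℕ → Bool}
    (hω : ∀ ε > 0, ∀ᶠ n : ℕ in atTop, |deviation A t c ω n| ≤ ε * n) :
    ∀ᶠ n in atTop, mass (tilt A t c) n ω ≤ (κ * len c n) ^ d := by
  obtain ⟨δ, hδ, hδA, hδB⟩ : ∃ δ > 0, δ ≤ Real.log 2 - d * Real.log A ∧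
      δ ≤ -(t * Real.log t + (1 - t) * Real.log (1 - t)) - d * Real.log B :=
    ⟨_, lt_min (sub_pos.2 hdA) (sub_pos.2 hdB), min_le_left _ _, min_le_right _ _⟩
  set K := |Real.log t - Real.log (1 - t)| with hK
  have hK0 : 0 ≤ K := abs_nonneg _
  have hlarge : ∀ᶠ n : ℕ in atTop, -(d * Real.log κ) ≤ δ / 2 * n :=
    (tendsto_natCast_atTop_atTop.const_mul_atTop (half_pos hδ)).eventually_ge_atTop _
  filter_upwards [hω (δ / 2 / (K + 1)) (by positivity), hlarge] with n hn hl
  have hpos : 0 < mass (tilt A t c) n ω := by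
    refine Finset.prod_pos fun i _ => ?_
    unfold tilt
    split_ifs <;> linarith
  rw [← Real.log_le_log_iff hpos (Real.rpow_pos_of_pos (mul_pos hκ (h.ratios.len_pos n)) _),
    Real.log_rpow (mul_pos hκ (h.ratios.len_pos n)), Real.log_mul hκ.ne' (h.ratios.len_pos n).ne',
    h.log_len, log_mass_tilt h0 h1]
  have hAB : (numA A c n : ℝ) + numB A c n = n := by exact_mod_cast numA_add_numB A c n
  have hS : deviation A t c ω n * (Real.log t - Real.log (1 - t)) ≤ δ / 2 * n := by
    refine (le_abs_self _).trans ?_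
    rw [abs_mul]
    calc _ ≤ δ / 2 / (K + 1) * n * K := mul_le_mul_of_nonneg_right hn hK0
      _ = δ / 2 * n * (K / (K + 1)) := by ring
      _ ≤ δ / 2 * n * 1 := mul_le_mul_of_nonneg_left
          (div_le_one_of_le₀ (by linarith) (by positivity)) (by positivity)
      _ = δ / 2 * n := mul_one _
  have h3 := mul_le_mul_of_nonneg_left hδA (Nat.cast_nonneg (α := ℝ) (numA A c n))
  have h4 := mul_le_mul_of_nonneg_left hδB (Nat.cast_nonneg (α := ℝ) (numB A c n))
  rw [← hAB] at hS hl
  linarith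

lemma Phases.ofReal_le_dimH (h : Phases A B p q N c r) {E : Set ℝ} {α d t : ℝ} (hα0 : 0 ≤ α)
    (hα : -Real.log p ≤ α * Real.log A) (h0 : 0 < t) (h1 : t < 1)
    (ht : α * Real.log B = -(t * Real.log q + (1 - t) * Real.log (1 - q))) (hd : 0 < d)
    (hdA : d * Real.log A < Real.log 2)
    (hdB : d * Real.log B < -(t * Real.log t + (1 - t) * Real.log (1 - t)))
    (hE : ∀ ω, limsup (ratio c r ω) atTop = α → coding c ω ∈ E) :
    ENNReal.ofReal d ≤ dimH E := by
  have hϑ : ∀ i, 0 ≤ tilt A t c i ∧ tilt A t c i ≤ 1 := fun i => by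
    unfold tilt
    split_ifs <;> constructor <;> linarith
  have hw : ∀ i, |indB A c i| ≤ 1 := fun i => by
    unfold indB
    split_ifs <;> simp
  obtain ⟨P, hP, hmass, hlln⟩ := exists_bernoulli (fun i => (hϑ i).1) (fun i => (hϑ i).2) hw
  refine Moran.ofReal_le_dimH h.ratios (P := P) hd ?_ ?_
  · filter_upwards [hlln] with ω hω
    exact hE ω (h.limsup_ratio hα0 hα ht hω)
  · filter_upwards [hlln] with ω hω
    filter_upwards [h.eventually_mass_tilt_le h0 h1 hdA hdB
      (div_pos h.ratios.gap_pos h.ratios.A_pos) hω] with n hn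
    rw [hmass]
    exact ENNReal.ofReal_le_ofReal hn

lemma exists_log_exp_add_exp_le {x y η : ℝ} (hxy : x ≠ y) (hη : 0 < η) :
    ∃ s : ℝ, -(s * y) + Real.log (Real.exp (s * x) + Real.exp (s * y)) ≤ η := by
  refine ⟨Real.log η / (x - y), ?_⟩
  set s := Real.log η / (x - y) with hs
  have hsη : s * x = s * y + Real.log η := by
    rw [hs]
    field_simp [sub_ne_zero.2 hxy]
    ring
  have hsum : Real.exp (s * x) + Real.exp (s * y) = Real.exp (s * y) * (η + 1) := by
    rw [hsη, Real.exp_add, Real.exp_log hη]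
    ring
  rw [hsum, Real.log_mul (Real.exp_pos _).ne' (by positivity), Real.log_exp]
  linarith [Real.log_le_sub_one_of_pos (show 0 < η + 1 by positivity)]

lemma Phases.legendre_mul_log_le (h : Phases A B p q N c r) {α : ℝ}
    (hα1 : -Real.log (1 - q) / Real.log B ≤ α) (hα2 : α ≤ -Real.log q / Real.log B) (s : ℝ) :
    legendre (betaFn q B) α * Real.log B ≤ s * (α * Real.log B) +
      Real.log (Real.exp (s * Real.log q) + Real.exp (s * Real.log (1 - q))) := by
  have hbdd : BddBelow (range fun s : ℝ => s * α - betaFn q B s) :=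
    ⟨0, by rintro _ ⟨s, rfl⟩; exact h.sub_betaFn_nonneg hα1 hα2 s⟩
  have hle : legendre (betaFn q B) α ≤ s * α - betaFn q B s := ciInf_le hbdd s
  refine (mul_le_mul_of_nonneg_right hle h.log_B_pos.le).trans_eq ?_
  rw [betaFn, Real.rpow_def_of_pos h.q_pos, Real.rpow_def_of_pos (by linarith [h.q_le] : 0 < 1 - q),
    sub_mul, div_mul_cancel₀ _ h.log_B_pos.ne', mul_comm (Real.log q), mul_comm (Real.log (1 - q))]
  ring

/-- Unless the Legendre transform vanishes, it is the entropy of a Bernoulli measure. -/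
lemma Phases.exists_param (h : Phases A B p q N c r) {α : ℝ}
    (hα1 : -Real.log (1 - q) / Real.log B ≤ α) (hα2 : α ≤ -Real.log q / Real.log B) :
    legendre (betaFn q B) α ≤ 0 ∨ ∃ t, 0 < t ∧ t < 1 ∧
      α * Real.log B = -(t * Real.log q + (1 - t) * Real.log (1 - q)) ∧
      legendre (betaFn q B) α * Real.log B ≤
        -(t * Real.log t + (1 - t) * Real.log (1 - t)) := by
  have hlB := h.log_B_pos
  have hleg := h.legendre_mul_log_le hα1 hα2
  rw [div_le_iff₀ hlB] at hα1
  rw [le_div_iff₀ hlB] at hα2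
  rcases h.q_le.eq_or_lt with hq | hq
  · right
    have hhalf : (1 : ℝ) - 1 / 2 = 1 / 2 := by norm_num
    refine ⟨1 / 2, by norm_num, by norm_num, ?_, ?_⟩
    · rw [hq, hhalf] at hα1
      rw [hq] at hα2 ⊢
      rw [hhalf]
      linarith
    · refine (hleg 0).trans_eq ?_
      have : Real.log (1 / 2) = -Real.log 2 := by rw [one_div, Real.log_inv]
      rw [hhalf, this]
      norm_num
      ring
  have hlt : Real.log q < Real.log (1 - q) := Real.log_lt_log h.q_pos (by linarith)
  set x := Real.log q with hx
  set y := Real.log (1 - q) with hy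
  have hyx : 0 < y - x := sub_pos.2 hlt
  set t := (α * Real.log B + y) / (y - x) with ht
  have htα : α * Real.log B = -(t * x + (1 - t) * y) := by
    have : t * (y - x) = α * Real.log B + y := div_mul_cancel₀ _ hyx.ne'
    linarith
  have ht0 : 0 ≤ t := div_nonneg (by linarith) hyx.le
  have ht1 : t ≤ 1 := div_le_one_of_le₀ (by linarith) hyx.le
  rcases ht0.eq_or_lt with h0 | h0
  · left
    by_contra! hcon
    obtain ⟨s, hs⟩ := exists_log_exp_add_exp_le hlt.ne (half_pos (mul_pos hcon hlB))
    have := hleg s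
    rw [htα, ← h0] at this
    linarith [mul_pos hcon hlB]
  rcases ht1.eq_or_lt with h1 | h1
  · left
    by_contra! hcon
    obtain ⟨s, hs⟩ := exists_log_exp_add_exp_le hlt.ne' (half_pos (mul_pos hcon hlB))
    have := hleg s
    rw [htα, h1, add_comm (Real.exp _)] at this
    linarith [mul_pos hcon hlB]
  · right
    refine ⟨t, h0, h1, htα, ?_⟩
    obtain ⟨s, hs⟩ : ∃ s, s * (x - y) = Real.log t - Real.log (1 - t) :=
      ⟨_, div_mul_cancel₀ _ (sub_neg.2 hlt).ne⟩
    obtain ⟨M, hM⟩ : ∃ M, M = s * x - Real.log t := ⟨_, rfl⟩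
    have hsx : s * x = M + Real.log t := by linarith
    have hsy : s * y = M + Real.log (1 - t) := by linarith
    have hsum : Real.exp (s * x) + Real.exp (s * y) = Real.exp M := by
      rw [hsx, hsy, Real.exp_add, Real.exp_add, Real.exp_log h0, Real.exp_log (sub_pos.2 h1)]
      ring
    refine (hleg s).trans_eq ?_
    rw [hsum, Real.log_exp, htα]
    linear_combination (-t) * hsx - (1 - t) * hsy

lemma Phases.le_dimH (h : Phases A B p q N c r)
    (hpq : -Real.log p / Real.log A < -Real.log (1 - q) / Real.log B) {E : Set ℝ} {α : ℝ}
    (hα1 : -Real.log (1 - q) / Real.log B ≤ α) (hα2 : α ≤ -Real.log q / Real.log B)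
    (hE : ∀ ω, limsup (ratio c r ω) atTop = α → coding c ω ∈ E) :
    ENNReal.ofReal (min (Real.log 2 / Real.log A) (legendre (betaFn q B) α)) ≤ dimH E := by
  have hα : -Real.log p ≤ α * Real.log A := by
    rw [← div_le_iff₀ h.log_A_pos]
    exact hpq.le.trans hα1
  have hα0 : 0 ≤ α := le_trans (div_nonneg (neg_nonneg.2 (Real.log_nonpos
    (by linarith [h.q_le]) (by linarith [h.q_pos]))) h.log_B_pos.le) hα1
  rcases h.exists_param hα1 hα2 with hle | ⟨t, h0, h1, ht, hleg⟩
  · rw [ENNReal.ofReal_of_nonpos ((min_le_right _ _).trans hle)]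
    exact zero_le
  refine le_of_forall_lt_imp_le_of_dense fun a ha => ?_
  have hfin : a ≠ ⊤ := ha.ne_top
  rw [ENNReal.lt_ofReal_iff_toReal_lt hfin, lt_min_iff, lt_div_iff₀ h.log_A_pos] at ha
  rcases (ENNReal.toReal_nonneg (a := a)).eq_or_lt with hz | hpos
  · rw [← ENNReal.ofReal_toReal hfin, ← hz, ENNReal.ofReal_zero]
    exact zero_le
  · rw [← ENNReal.ofReal_toReal hfin]
    exact h.ofReal_le_dimH hα0 hα h0 h1 ht hpos ha.1
      ((mul_lt_mul_of_pos_right ha.2 h.log_B_pos).trans_le hleg) hE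


end Moran

/-- for every α with −log(1−q)/log B ≤ α ≤ −log q/log B, the Hausdorff
dimension of Ē(μ,α) equals min{log 2/log A, β₂^*(α)}. -/
theorem stmt_10 (A B p q : ℝ) (N : ℕ → ℕ)
    (hBA : B < A) (hB2 : 2 < B)
    (hp0 : 0 < p) (hp2 : p ≤ 1 / 2) (hq0 : 0 < q) (hq2 : q ≤ 1 / 2)
    (hN0 : N 0 = 0) (hNmono : StrictMono N)
    (hNlim : Tendsto (fun i : ℕ => (N (i + 1) : ℝ) / (N i : ℝ)) atTop atTop)
    (hpq : -Real.log p / Real.log A < -Real.log (1 - q) / Real.log B)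
    (c r : ℕ → ℝ)
    (hcA : ∀ i n : ℕ, N (2 * i) < n → n ≤ N (2 * i + 1) → c n = A)
    (hcB : ∀ i n : ℕ, N (2 * i + 1) < n → n ≤ N (2 * i + 2) → c n = B)
    (hrp : ∀ i n : ℕ, N (2 * i) < n → n ≤ N (2 * i + 1) → r n = p)
    (hrq : ∀ i n : ℕ, N (2 * i + 1) < n → n ≤ N (2 * i + 2) → r n = q)
    (μ : Measure ℝ) [IsProbabilityMeasure μ]
    (hμ : ∀ w : List Bool, μ (moranI c w) = ENNReal.ofReal (cylMass r w 1 1))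
    (α : ℝ)
    (hα1 : -Real.log (1 - q) / Real.log B ≤ α)
    (hα2 : α ≤ -Real.log q / Real.log B) :
    dimH {x | x ∈ moranSet c ∧ upperLocalDim μ x = α} =
      ENNReal.ofReal (min (Real.log 2 / Real.log A) (legendre (betaFn q B) α)) := by
  have h : Moran.Phases A B p q N c r :=
    ⟨hBA, hB2, hp0, hp2, hq0, hq2, hN0, hNmono, hNlim, hcA, hcB, hrp, hrq⟩
  have hμ' : ∀ n ω, μ (Moran.cyl c n ω) = ENNReal.ofReal (Moran.mass r n ω) := fun n ω => by
    rw [← Moran.moranI_word, hμ, Moran.cylMass_word]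
  refine le_antisymm (h.dimH_le hpq hα1 hα2 ?_) (h.le_dimH hpq hα1 hα2 ?_)
  · rintro x ⟨hx, hdim⟩
    obtain ⟨ω, rfl⟩ := h.ratios.mem_moranSet_iff.1 hx
    exact ⟨ω, rfl, by rw [← Moran.upperLocalDim_coding h.ratios h.weights hμ' ω, hdim]⟩
  · intro ω hω
    exact ⟨h.ratios.mem_moranSet_iff.2 ⟨ω, rfl⟩,
      (Moran.upperLocalDim_coding h.ratios h.weights hμ' ω).trans hω⟩
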